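/- For every ε > 0 there is a constant C_ε such that for every integer q ≥ 2, every interval I ⊆ [0,q) and every integer n, the incomplete Kloosterman sum satisfies |S_I(0,n;q)| ≤ C_ε · gcd(n,q)^{1/2} · q^{1/2+ε}. -/

import Mathlib

open Real Complex
open scoped Classical

/-- The incomplete Kloosterman sum `S_I(0,n;q) = Σ_{x ∈ I∩ℤ, gcd(x,q)=1} e(n x̄/q)`,
where `x̄` is the multiplicative inverse of `x (mod q)`. -/
noncomputable def kloosterman (q : ℕ) (n : ℤ) (I : Set ℝ) : ℂ :=
  ∑ x ∈ Finset.range q,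
    if (x : ℝ) ∈ I ∧ Nat.gcd x q = 1 then
      Complex.exp (2 * Real.pi * Complex.I *
        ((n : ℂ) * (((x : ZMod q)⁻¹).val : ℂ) / (q : ℂ)))
    else 0

section Stepanov

open Polynomial

theorem pow_sub_dvd_hasseDeriv_pow_mul {R : Type*} [CommRing R] (f u : R[X]) (N k : ℕ) :
    f ^ (N - k) ∣ hasseDeriv k (f ^ N * u) := by
  induction N generalizing k with
  | zero => simp
  | succ N ih =>
    rw [pow_succ', mul_assoc, hasseDeriv_mul]
    refine Finset.dvd_sum fun ij hij => ?_
    obtain ⟨i, j⟩ := ij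
    have hij : i + j = k := by simpa using hij
    rcases Nat.eq_zero_or_pos i with rfl | hi
    · obtain rfl : j = k := by omega
      rw [hasseDeriv_zero']
      refine (pow_dvd_pow f (show N + 1 - j ≤ N - j + 1 by omega)).trans ?_
      rw [pow_succ']
      exact mul_dvd_mul_left _ (ih j)
    · exact ((pow_dvd_pow f (show N + 1 - k ≤ N - j by omega)).trans (ih j)).mul_left _

theorem X_sub_C_pow_dvd_of_hasseDeriv {R : Type*} [CommRing R] (h : R[X]) (x : R) (l : ℕ)
    (H : ∀ k < l, (hasseDeriv k h).eval x = 0) : (X - C x) ^ l ∣ h := by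
  have h1 : X ^ l ∣ taylor x h := by
    rw [X_pow_dvd_iff]
    intro d hd
    rw [taylor_coeff, H d hd]
  obtain ⟨g, hg⟩ := h1
  refine ⟨taylor (-x) g, ?_⟩
  have : h = taylor (-x) (taylor x h) := by simp [taylor_taylor]
  rw [this, hg, taylor_mul, taylor_pow, taylor_X]
  simp [sub_eq_add_neg]

theorem eq_zero_of_squarefree_mul_sq_eq {F : Type*} [Field F] (f : F[X]) (hf : Squarefree f)
    (hdeg : 0 < f.natDegree) (c : F) (hc : c ≠ 0) (n : ℕ) (r s : F[X]) (hn : s.natDegree ≤ n)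
    (h : f * r ^ 2 = C c * s ^ 2) : s = 0 := by
  have hf0 : f ≠ 0 := hf.ne_zero
  have hu : IsUnit (C c) := isUnit_C.mpr hc.isUnit
  induction n using Nat.strong_induction_on generalizing r s with
  | _ n ih =>
  by_contra hs
  have h1 : f ∣ s ^ 2 := by
    rw [← hu.dvd_mul_left (a := f), ← h]; exact dvd_mul_right _ _
  have h2 : f ∣ s := (hf.dvd_pow_iff_dvd two_ne_zero).mp h1
  obtain ⟨t, rfl⟩ := h2
  have h3 : r ^ 2 = C c * f * t ^ 2 := by
    apply mul_left_cancel₀ hf0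
    rw [h]; ring
  have h4 : f ∣ r := (hf.dvd_pow_iff_dvd two_ne_zero).mp ⟨C c * t ^ 2, by rw [h3]; ring⟩
  obtain ⟨u, rfl⟩ := h4
  have h5 : f * u ^ 2 = C c * t ^ 2 := by
    apply mul_left_cancel₀ hf0
    linear_combination h3
  have ht : t ≠ 0 := fun h => hs (by simp [h])
  rw [natDegree_mul hf0 ht] at hn
  exact ht (ih t.natDegree (by omega) u t le_rfl h5)

theorem eq_zero_of_sum_mul_X_pow_eq_zero {F : Type*} [Field F] [Fintype F] (f : F[X])
    (hf : Squarefree f) (hdeg : 0 < f.natDegree) (hf0 : f.coeff 0 ≠ 0) (e D : ℕ)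
    (hq : Fintype.card F = 2 * e + 1) (hD : 2 * D + f.natDegree < Fintype.card F) (J : ℕ)
    (r s : ℕ → F[X]) (hr : ∀ j, (r j).natDegree ≤ D) (hs : ∀ j, (s j).natDegree ≤ D)
    (h : ∑ j ∈ Finset.range J, (r j + s j * f ^ e) * X ^ (j * Fintype.card F) = 0) :
    ∀ j < J, r j = 0 ∧ s j = 0 := by
  set q := Fintype.card F with hqdef
  induction J generalizing r s with
  | zero => simp
  | succ J ih =>
    have hX : ∀ (u : ℕ → F[X]), ∃ v, ∑ j ∈ Finset.range (J + 1), u j * X ^ (j * q) =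
        u 0 + X ^ q * v := fun u => by
      refine ⟨∑ j ∈ Finset.range J, u (j + 1) * X ^ (j * q), ?_⟩
      rw [Finset.sum_range_succ', Finset.mul_sum, add_comm]
      simp only [zero_mul, pow_zero, mul_one]
      congr 1
      refine Finset.sum_congr rfl fun j _ => ?_
      ring
    obtain ⟨v, hv⟩ := hX r
    obtain ⟨w, hw⟩ := hX s
    have h1 : (r 0 + X ^ q * v) + (s 0 + X ^ q * w) * f ^ e = 0 := by
      rw [← hv, ← hw, ← h, Finset.sum_mul, ← Finset.sum_add_distrib]
      exact Finset.sum_congr rfl fun j _ => by ring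
    have h2 : X ^ q ∣ f ^ q - C (f.coeff 0) := by
      obtain ⟨g, hg⟩ : X ∣ f - C (f.coeff 0) := by
        rw [X_dvd_iff]; simp
      refine ⟨expand F q g, ?_⟩
      rw [← FiniteField.expand_card]
      have := congrArg (expand F q) hg
      simpa using this
    obtain ⟨g, hg⟩ := h2
    have h3 : f * r 0 ^ 2 - C (f.coeff 0) * s 0 ^ 2 = 0 := by
      by_contra hne
      have hdvd : X ^ q ∣ f * r 0 ^ 2 - C (f.coeff 0) * s 0 ^ 2 := by
        have e1 : f * (r 0 + X ^ q * v) ^ 2 = (s 0 + X ^ q * w) ^ 2 * f ^ q := by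
          rw [show r 0 + X ^ q * v = -((s 0 + X ^ q * w) * f ^ e) by linear_combination h1, hq]
          ring
        refine ⟨s 0 ^ 2 * g + (2 * s 0 * w + X ^ q * w ^ 2) * f ^ q
          - f * (2 * r 0 * v + X ^ q * v ^ 2), ?_⟩
        linear_combination e1 + s 0 ^ 2 * hg
      have := natDegree_le_of_dvd hdvd hne
      rw [natDegree_X_pow] at this
      have h4 : (f * r 0 ^ 2 - C (f.coeff 0) * s 0 ^ 2).natDegree ≤ 2 * D + f.natDegree := by
        refine (natDegree_sub_le _ _).trans (max_le ?_ ?_)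
        · refine natDegree_mul_le.trans ?_
          have := natDegree_pow_le (p := r 0) (n := 2)
          have := hr 0
          omega
        · refine natDegree_mul_le.trans ?_
          have := natDegree_pow_le (p := s 0) (n := 2)
          have := hs 0
          rw [natDegree_C]
          omega
      omega
    have hs0 : s 0 = 0 := eq_zero_of_squarefree_mul_sq_eq f hf hdeg _ hf0 _ (r 0) (s 0) le_rfl
      (sub_eq_zero.mp h3)
    have hr0 : r 0 = 0 := by
      rw [hs0] at h3
      simpa [hf.ne_zero] using h3
    have hrest := ih (fun j => r (j + 1)) (fun j => s (j + 1)) (fun j => hr _) (fun j => hs _) (by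
      have hXq : (X : F[X]) ^ q ≠ 0 := pow_ne_zero _ X_ne_zero
      apply mul_left_cancel₀ hXq
      rw [mul_zero, ← h, Finset.sum_range_succ', hr0, hs0, Finset.mul_sum]
      simp only [zero_mul, add_zero]
      exact Finset.sum_congr rfl fun j _ => by ring)
    intro j hj
    rcases j with _ | j
    · exact ⟨hr0, hs0⟩
    · exact hrest j (by omega)

theorem exists_auxiliary_coefficients {F : Type*} [Field F] (f : F[X]) (hf : f ≠ 0)
    (e l J D : ℕ) (hcount : l * (D + J + l * f.natDegree) < 2 * J * D) :
    ∃ r s : ℕ → F[X], (∀ j, (r j).natDegree ≤ D - 1) ∧ (∀ j, (s j).natDegree ≤ D - 1) ∧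
      (∃ j < J, ¬ (r j = 0 ∧ s j = 0)) ∧
      ∀ k < l, ∑ j ∈ Finset.range J, (hasseDeriv k (f ^ l * r j) * f ^ e -
        hasseDeriv k (f ^ (l + e) * s j)) * X ^ j = 0 := by
  set m := f.natDegree with hm
  have hD : 0 < D := by
    rcases Nat.eq_zero_or_pos D with h | h
    · subst h; simp at hcount
    · exact h
  set M := D + J + l * m with hM
  let V := (Fin J → degreeLT F D) × (Fin J → degreeLT F D)
  have hdegLT : ∀ u : degreeLT F D, (u : F[X]).natDegree ≤ D - 1 := fun u => by
    have := mem_degreeLT.mp u.2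
    by_cases hu : (u : F[X]) = 0
    · simp [hu]
    · rw [← natDegree_lt_iff_degree_lt hu] at this
      omega
  let W : Fin l → Submodule F F[X] := fun k =>
    (degreeLT F M).map (LinearMap.mulLeft F (f ^ (l - k.1 + e)))
  have hWfin : ∀ k, Module.finrank F (W k) ≤ M := fun k => by
    refine (Submodule.finrank_map_le _ _).trans ?_
    rw [(degreeLTEquiv F M).finrank_eq]
    simp
  let Phi : Fin l → V →ₗ[F] F[X] := fun k =>
    ∑ j : Fin J, LinearMap.mulRight F (X ^ j.1 : F[X]) ∘ₗ
      (LinearMap.mulRight F (f ^ e) ∘ₗ hasseDeriv k.1 ∘ₗ LinearMap.mulLeft F (f ^ l) ∘ₗ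
        (degreeLT F D).subtype ∘ₗ LinearMap.proj j ∘ₗ LinearMap.fst F _ _ -
      hasseDeriv k.1 ∘ₗ LinearMap.mulLeft F (f ^ (l + e)) ∘ₗ
        (degreeLT F D).subtype ∘ₗ LinearMap.proj j ∘ₗ LinearMap.snd F _ _)
  have hPhi : ∀ (k : Fin l) (v : V), Phi k v = ∑ j : Fin J,
      (hasseDeriv k.1 (f ^ l * (v.1 j : F[X])) * f ^ e -
        hasseDeriv k.1 (f ^ (l + e) * (v.2 j : F[X]))) * X ^ j.1 := fun k v => by
    simp only [Phi, LinearMap.sum_apply]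
    rfl
  have hmem : ∀ (k : Fin l) (v : V), Phi k v ∈ W k := fun k v => by
    have hd : f ^ (l - k.1 + e) ∣ Phi k v := by
      rw [hPhi]
      refine Finset.dvd_sum fun j _ => Dvd.dvd.mul_right (dvd_sub ?_ ?_) _
      · rw [pow_add]
        exact mul_dvd_mul_right (pow_sub_dvd_hasseDeriv_pow_mul _ _ _ _) _
      · have h1 : l - k.1 + e = l + e - k.1 := by have := k.2; omega
        rw [h1]
        exact pow_sub_dvd_hasseDeriv_pow_mul _ _ _ _
    obtain ⟨g, hg⟩ := hd
    refine ⟨g, ?_, hg.symm⟩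
    by_cases hg0 : g = 0
    · rw [hg0]; exact Submodule.zero_mem _
    have hpow : ∀ N, (f ^ N).natDegree = N * m := fun N => natDegree_pow f N
    have hdegmul : ∀ N (u : degreeLT F D), (hasseDeriv k.1 (f ^ N * (u : F[X]))).natDegree ≤
        N * m + (D - 1) := fun N u =>
      (natDegree_hasseDeriv_le _ _).trans ((Nat.sub_le _ _).trans
        (natDegree_mul_le.trans (by rw [hpow]; exact Nat.add_le_add_left (hdegLT _) _)))
    have hle : (Phi k v).natDegree ≤ (l + e) * m + (D - 1) + (J - 1) := by
      rw [hPhi]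
      refine natDegree_sum_le_of_forall_le _ _ fun j _ => ?_
      refine natDegree_mul_le.trans ?_
      rw [natDegree_X_pow]
      have hj : j.1 ≤ J - 1 := by have := j.2; omega
      refine Nat.add_le_add ?_ hj
      refine (natDegree_sub_le _ _).trans (max_le ?_ (hdegmul _ _))
      refine natDegree_mul_le.trans ?_
      have := hdegmul l (v.1 j)
      rw [hpow, add_mul]
      omega
    rw [hg, natDegree_mul (pow_ne_zero _ hf) hg0, hpow] at hle
    have hk : (l - k.1 + e) * m + k.1 * m = (l + e) * m := by
      rw [← add_mul]; congr 1; have := k.2; omega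
    have hkl : k.1 * m ≤ l * m := Nat.mul_le_mul_right _ k.2.le
    have hJ : 0 < J := by
      rcases Nat.eq_zero_or_pos J with h | h
      · subst h; simp at hcount
      · exact h
    exact mem_degreeLT.mpr ((natDegree_lt_iff_degree_lt hg0).mp (by omega))
  let Psi : V →ₗ[F] ((k : Fin l) → W k) :=
    LinearMap.pi fun k => (Phi k).codRestrict (W k) (hmem k)
  have hfin : Module.finrank F ((k : Fin l) → W k) < Module.finrank F V := by
    have h1 : Module.finrank F V = 2 * J * D := by
      simp only [V, Module.finrank_prod, Module.finrank_pi_fintype, (degreeLTEquiv F D).finrank_eq]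
      simp
      ring
    rw [h1, Module.finrank_pi_fintype]
    refine lt_of_le_of_lt (Finset.sum_le_sum fun k _ => hWfin k) ?_
    simpa using hcount
  obtain ⟨v, hvker, hv0⟩ :=
    Submodule.exists_mem_ne_zero_of_ne_bot (LinearMap.ker_ne_bot_of_finrank_lt (f := Psi) hfin)
  refine ⟨fun j => if h : j < J then (v.1 ⟨j, h⟩ : F[X]) else 0,
    fun j => if h : j < J then (v.2 ⟨j, h⟩ : F[X]) else 0, ?_, ?_, ?_, ?_⟩
  · intro j
    dsimp only
    split_ifs
    · exact hdegLT _
    · simp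
  · intro j
    dsimp only
    split_ifs
    · exact hdegLT _
    · simp
  · by_contra! hall
    apply hv0
    ext j : 2
    · have := (hall j.1 j.2).1
      simpa using this
    · have := (hall j.1 j.2).2
      simpa using this
  · intro k hk
    have h1 : Phi ⟨k, hk⟩ v = 0 := by
      have := congrFun (LinearMap.mem_ker.mp hvker) ⟨k, hk⟩
      exact congrArg Subtype.val this
    rw [hPhi] at h1
    rw [← h1, Finset.sum_range]
    refine Finset.sum_congr rfl fun j _ => ?_
    simp

theorem X_pow_card_sub_C {F : Type*} [Field F] [Fintype F] (x : F) :
    (X : F[X]) ^ Fintype.card F - C x = (X - C x) ^ Fintype.card F := by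
  rw [← FiniteField.expand_card (X - C x), map_sub, expand_X, expand_C]

theorem mul_card_le_natDegree_of_X_sub_C_pow_dvd {F : Type*} [Field F] (S : Finset F) (R : F[X])
    (hR : R ≠ 0) (l : ℕ) (h : ∀ x ∈ S, (X - C x) ^ l ∣ R) : l * S.card ≤ R.natDegree := by
  have h1 : ∏ x ∈ S, (X - C x) ^ l ∣ R := by
    refine Finset.prod_dvd_of_coprime (fun x _ y _ hxy => ?_) h
    exact (pairwise_coprime_X_sub_C Function.injective_id hxy).pow
  have h2 := natDegree_le_of_dvd h1 hR
  rw [natDegree_prod_of_monic _ _ fun x _ => (monic_X_sub_C x).pow l] at h2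
  simp only [natDegree_pow, natDegree_X_sub_C, mul_one, Finset.sum_const, smul_eq_mul] at h2
  rwa [mul_comm]

/-- Stepanov's bound for the number of points where a squarefree polynomial takes
non-square values. -/
theorem stepanov_card_le {F : Type*} [Field F] [Fintype F] (f : F[X])
    (hf : Squarefree f) (hdeg : 0 < f.natDegree) (hf0 : f.coeff 0 ≠ 0) (e Q : ℕ)
    (hq : Fintype.card F = 2 * e + 1) (hQ : Fintype.card F = Q ^ 2)
    (hQm : 4 * f.natDegree + 4 ≤ Q) :
    2 * (Finset.univ.filter fun x : F => f.eval x ^ e = -1).card ≤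
      Q ^ 2 + (11 * f.natDegree + 6) * Q := by
  set m := f.natDegree with hm
  have hQodd : Odd Q := by
    have : Odd (Q ^ 2) := ⟨e, by omega⟩
    exact (Nat.odd_pow_iff two_ne_zero).mp this
  obtain ⟨t, ht⟩ := hQodd
  set J := t + 4 * m + 3 with hJ
  have hJ2 : 2 * J = Q + 8 * m + 5 := by omega
  have hme : m < e := by nlinarith
  set D := e - m with hD
  have hDe : e = D + m := by omega
  have hqQ : Q ^ 2 = 2 * e + 1 := by omega
  have hcount : Q * (D + J + Q * m) < 2 * J * D := by
    obtain ⟨u, hu⟩ : ∃ u, Q = 4 * m + 4 + u := ⟨Q - (4 * m + 4), by omega⟩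
    have h2D : 2 * D + 2 * m + 1 = Q ^ 2 := by omega
    have key : (8 * m + 5) * (Q + 1 + 2 * m) < Q ^ 2 * (6 * m + 4) := by
      rw [hu]; ring_nf; nlinarith [Nat.zero_le (m * u), Nat.zero_le (m * u ^ 2)]
    have : 2 * (Q * (D + J + Q * m)) < 2 * (2 * J * D) := by
      zify at *
      have e1 : (2 : ℤ) * D = Q ^ 2 - 2 * m - 1 := by linarith
      have e2 : (2 : ℤ) * J = Q + 8 * m + 5 := by exact_mod_cast hJ2
      have l1 : (2 : ℤ) * (Q * (D + J + Q * m)) = Q * (2 * D) + Q * (2 * J) + 2 * Q ^ 2 * m := by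
        ring
      have l2 : (2 : ℤ) * (2 * J * D) = (2 * J) * (2 * D) := by ring
      rw [l1, l2, e1, e2]
      nlinarith
    omega
  obtain ⟨r, s, hr, hs, ⟨j0, hj0, hne⟩, hvan⟩ :=
    exists_auxiliary_coefficients f hf.ne_zero e Q J D hcount
  set q := Fintype.card F with hqdef
  set R : F[X] := ∑ j ∈ Finset.range J, (f ^ Q * r j + f ^ (Q + e) * s j) * X ^ (j * q) with hRdef
  have hR0 : R ≠ 0 := by
    intro h0
    have h1 : f ^ Q * ∑ j ∈ Finset.range J, (r j + s j * f ^ e) * X ^ (j * q) = 0 := by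
      rw [← h0, Finset.mul_sum]
      exact Finset.sum_congr rfl fun j _ => by ring
    have h2 := (mul_eq_zero.mp h1).resolve_left (pow_ne_zero _ hf.ne_zero)
    exact hne (eq_zero_of_sum_mul_X_pow_eq_zero f hf hdeg hf0 e (D - 1) hq (by omega) J r s hr hs
      h2 j0 hj0)
  have hRdeg : R.natDegree ≤ Q * m + e * m + D + (J - 1) * q := by
    refine natDegree_sum_le_of_forall_le _ _ fun j hj => ?_
    refine natDegree_mul_le.trans ?_
    rw [natDegree_X_pow]
    have hj' : j ≤ J - 1 := by have := Finset.mem_range.mp hj; omega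
    refine Nat.add_le_add ?_ (Nat.mul_le_mul_right _ hj')
    refine (natDegree_add_le _ _).trans (max_le ?_ ?_)
    · refine natDegree_mul_le.trans ?_
      rw [natDegree_pow, ← hm]
      have := hr j
      omega
    · refine natDegree_mul_le.trans ?_
      rw [natDegree_pow, ← hm, add_mul]
      have := hs j
      omega
  have hdvd : ∀ x ∈ Finset.univ.filter (fun x : F => f.eval x ^ e = -1), (X - C x) ^ Q ∣ R := by
    intro x hx
    have hx' : f.eval x ^ e = -1 := by simpa using hx
    set R' : F[X] := ∑ j ∈ Finset.range J, C (x ^ j) * (f ^ Q * r j + f ^ (Q + e) * s j) with hR'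
    have h1 : (X - C x) ^ q ∣ R - R' := by
      rw [hRdef, hR', ← Finset.sum_sub_distrib]
      refine Finset.dvd_sum fun j _ => ?_
      have h2 : (X - C x) ^ q ∣ (X : F[X]) ^ (j * q) - C (x ^ j) := by
        rw [← X_pow_card_sub_C, mul_comm j, pow_mul, C_pow]
        exact sub_dvd_pow_sub_pow _ _ _
      obtain ⟨g, hg⟩ := h2
      refine ⟨(f ^ Q * r j + f ^ (Q + e) * s j) * g, ?_⟩
      linear_combination (f ^ Q * r j + f ^ (Q + e) * s j) * hg
    have h2 : (X - C x) ^ Q ∣ R' := by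
      refine X_sub_C_pow_dvd_of_hasseDeriv _ _ _ fun k hk => ?_
      have h3 := congrArg (eval x) (hvan k hk)
      simp only [eval_finsetSum, eval_mul, eval_sub, eval_pow, eval_X, hx', eval_zero] at h3
      rw [hR', map_sum, eval_finsetSum, ← neg_eq_zero, ← h3, ← Finset.sum_neg_distrib]
      refine Finset.sum_congr rfl fun j _ => ?_
      rw [← smul_eq_C_mul, map_smul, map_add, eval_smul, eval_add, smul_eq_mul]
      ring
    have hQq : Q ≤ q := by rw [hQ]; exact Nat.le_self_pow two_ne_zero Q
    have := dvd_add ((pow_dvd_pow (X - C x) hQq).trans h1) h2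
    simpa using this
  have hfinal := (mul_card_le_natDegree_of_X_sub_C_pow_dvd _ R hR0 Q hdvd).trans hRdeg
  set N := (Finset.univ.filter fun x : F => f.eval x ^ e = -1).card
  have hQpos : 0 < Q := by omega
  have hJq : (J - 1) * q + q = J * Q ^ 2 := by
    rw [← hQ]
    obtain ⟨J', hJ'⟩ : ∃ J', J = J' + 1 := ⟨t + 4 * m + 2, by omega⟩
    rw [hJ']; simp; ring
  have h1 : Q * N ≤ Q * m + e * m + J * Q ^ 2 := by omega
  have h2 : Q * (2 * N) ≤ Q * (Q ^ 2 + (11 * m + 6) * Q) := by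
    have h3 : 2 * (e * m) ≤ Q ^ 2 * m := by rw [hqQ]; nlinarith
    have h4 : 2 * (J * Q ^ 2) = (Q + 8 * m + 5) * Q ^ 2 := by rw [← hJ2]; ring
    nlinarith [Nat.mul_le_mul_left Q (Nat.mul_le_mul_left m (show 1 ≤ Q by omega))]
  exact Nat.le_of_mul_le_mul_left h2 hQpos

end Stepanov

section PointCount

open Polynomial

theorem trace_pow_card {K L : Type*} [Field K] [Fintype K] [Field L] [Fintype L] [Algebra K L]
    (y : L) : Algebra.trace K L (y ^ Fintype.card K) = Algebra.trace K L y := by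
  rw [← Algebra.trace_eq_of_algEquiv (FiniteField.frobeniusAlgEquivOfAlgebraic K L) y]
  simp

theorem exists_pair_of_isSquare {L : Type*} [Field L] [Fintype L] (h2 : (2 : L) ≠ 0)
    (a b t : L) (ha : a ≠ 0) (hb : b ≠ 0) (h0 : t ^ 2 - 4 * (a * b) ≠ 0)
    (hsq : IsSquare (t ^ 2 - 4 * (a * b))) :
    2 ≤ (Finset.univ.filter fun x : L => x ≠ 0 ∧ a * x + b * x⁻¹ = t).card := by
  obtain ⟨w, hw⟩ := hsq
  have hw0 : w ≠ 0 := by rintro rfl; simp at hw; exact h0 hw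
  have key : ∀ v : L, v * v = t ^ 2 - 4 * (a * b) →
      ((t + v) / (2 * a)) ≠ 0 ∧ a * ((t + v) / (2 * a)) + b * ((t + v) / (2 * a))⁻¹ = t := by
    intro v hv
    have hne : t + v ≠ 0 := by
      intro h
      have : v = -t := by linear_combination h
      rw [this] at hv
      have h4 : (4 : L) * (a * b) = 0 := by linear_combination hv
      have : (4 : L) ≠ 0 := by
        rw [show (4 : L) = 2 * 2 by norm_num]; exact mul_ne_zero h2 h2
      simp_all
    refine ⟨div_ne_zero hne (mul_ne_zero h2 ha), ?_⟩
    field_simp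
    linear_combination hv
  rw [← Finset.card_pair (a := (t + w) / (2 * a)) (b := (t + -w) / (2 * a)) ?_]
  · apply Finset.card_le_card
    intro x hx
    rw [Finset.mem_insert, Finset.mem_singleton] at hx
    rw [Finset.mem_filter]
    refine ⟨Finset.mem_univ _, ?_⟩
    rcases hx with rfl | rfl
    · exact key w hw.symm
    · exact key (-w) (by rw [hw]; ring)
  · intro h
    rw [div_left_inj' (mul_ne_zero h2 ha)] at h
    have : (2 : L) * w = 0 := by linear_combination h
    exact hw0 ((mul_eq_zero.mp this).resolve_left h2)

theorem card_artinSchreier_ge {L : Type*} [Field L] [Fintype L] (h2 : (2 : L) ≠ 0)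
    (a b : L) (ha : a ≠ 0) (hb : b ≠ 0) (r Q : ℕ) (hr : 1 < r) (hrL : (r : L) = 0)
    (hQ : Fintype.card L = Q ^ 2) (hQr : 8 * r + 4 ≤ Q) :
    Q ^ 2 ≤ (Finset.univ.filter fun z : L × L =>
      z.1 ≠ 0 ∧ a * z.1 + b * z.1⁻¹ = z.2 ^ r - z.2).card + (22 * r + 6) * Q + 4 * r := by
  have h4 : (4 : L) * (a * b) ≠ 0 := by
    rw [show (4 : L) = 2 * 2 by norm_num]
    exact mul_ne_zero (mul_ne_zero h2 h2) (mul_ne_zero ha hb)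
  set c := (4 : L) * (a * b) with hc
  set g : L[X] := X ^ r - X with hg
  have hgdeg : g.natDegree = r := FiniteField.X_pow_card_sub_X_natDegree_eq L hr
  set f : L[X] := g ^ 2 - C c with hf
  have hfdeg : f.natDegree = 2 * r := by
    rw [hf, natDegree_sub_C, natDegree_pow, hgdeg]
  have hg' : derivative g = -1 := by
    rw [hg, derivative_sub, derivative_X_pow, derivative_X, hrL]; simp
  have hsep : f.Separable := by
    have hC2 : (C (2:L)) * C (2⁻¹ : L) = 1 := by rw [← C_mul, mul_inv_cancel₀ h2, C_1]
    have hCc : C c * C c⁻¹ = 1 := by rw [← C_mul, mul_inv_cancel₀ h4, C_1]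
    refine ⟨-C c⁻¹, -(C c⁻¹ * C (2⁻¹ : L) * g), ?_⟩
    have hd : derivative f = -(C 2 * g) := by
      rw [hf, derivative_sub, derivative_C, derivative_sq, hg']; simp
    rw [hd, hf]
    linear_combination hCc + C c⁻¹ * g ^ 2 * hC2
  have hcoeff : f.coeff 0 ≠ 0 := by
    rw [coeff_zero_eq_eval_zero, hf, hg]
    simpa [show r ≠ 0 by omega] using h4
  have hQodd : ringChar L ≠ 2 := fun h => h2 (by
    have := ringChar.Nat.cast_ringChar (R := L)
    rw [h] at this; exact_mod_cast this)
  have hoddcard : Fintype.card L % 2 = 1 := FiniteField.odd_card_of_char_ne_two hQodd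
  set e := Fintype.card L / 2 with he
  have hst := stepanov_card_le f hsep.squarefree (by omega) hcoeff e Q (by omega) hQ (by omega)
  have heval : ∀ y : L, f.eval y = (y ^ r - y) ^ 2 - 4 * (a * b) := fun y => by
    simp [hf, hg, hc]
  set Nm := (Finset.univ.filter fun y : L => f.eval y ^ e = -1).card with hNm
  set Np := (Finset.univ.filter fun y : L => f.eval y ≠ 0 ∧ f.eval y ^ e = 1).card with hNp
  have hN0 : (Finset.univ.filter fun y : L => f.eval y = 0).card ≤ 2 * r := by
    rw [← hfdeg]
    refine (Finset.card_le_card ?_).trans ((Multiset.toFinset_card_le _).trans (card_roots' f))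
    intro y hy
    rw [Multiset.mem_toFinset, mem_roots hsep.squarefree.ne_zero]
    simpa using hy
  have hsum : Q ^ 2 ≤ 2 * r + Nm + Np := by
    rw [← hQ, ← Finset.card_univ]
    refine (Finset.card_le_card (t := ((Finset.univ.filter fun y : L => f.eval y = 0) ∪
      (Finset.univ.filter fun y : L => f.eval y ^ e = -1)) ∪
      (Finset.univ.filter fun y : L => f.eval y ≠ 0 ∧ f.eval y ^ e = 1)) ?_).trans ?_
    · intro y _
      simp only [Finset.mem_union, Finset.mem_filter, Finset.mem_univ, true_and]
      by_cases h : f.eval y = 0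
      · exact Or.inl (Or.inl h)
      · rcases FiniteField.pow_dichotomy hQodd h with h' | h'
        · exact Or.inr ⟨h, h'⟩
        · exact Or.inl (Or.inr h')
    · refine (Finset.card_union_le _ _).trans ?_
      refine Nat.add_le_add_right ((Finset.card_union_le _ _).trans ?_) _
      exact Nat.add_le_add_right hN0 _
  have hpts : 2 * Np ≤ (Finset.univ.filter fun z : L × L =>
      z.1 ≠ 0 ∧ a * z.1 + b * z.1⁻¹ = z.2 ^ r - z.2).card := by
    rw [Finset.card_eq_sum_card_fiberwise (f := Prod.snd) (t := Finset.univ)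
      (fun _ _ => Finset.mem_coe.mpr (Finset.mem_univ _)), hNp, mul_comm, ← smul_eq_mul,
      ← Finset.sum_const]
    refine (Finset.sum_le_sum fun y hy => ?_).trans
      (Finset.sum_le_sum_of_subset (Finset.subset_univ _))
    have hy' := (Finset.mem_filter.mp hy).2
    have hsq := (FiniteField.isSquare_iff hQodd hy'.1).mpr hy'.2
    rw [heval] at hsq hy'
    refine (exists_pair_of_isSquare h2 a b (y ^ r - y) ha hb hy'.1 hsq).trans ?_
    refine Finset.card_le_card_of_injOn (fun x => (x, y)) ?_ ?_
    · intro x hx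
      have := (Finset.mem_filter.mp (Finset.mem_coe.mp hx)).2
      simpa using this
    · intro x _ x' _ h
      exact (Prod.mk.inj h).1
  rw [hfdeg] at hst
  nlinarith

theorem card_trace_eq_zero_ge {K L : Type*} [Field K] [Fintype K] [Field L] [Fintype L]
    [Algebra K L] (h2 : (2 : K) ≠ 0) (a b : L) (ha : a ≠ 0) (hb : b ≠ 0) (Q : ℕ)
    (hQ : Fintype.card L = Q ^ 2) (hQr : 8 * Fintype.card K + 4 ≤ Q) :
    Q ^ 2 ≤ Fintype.card K * (Finset.univ.filter fun x : L =>
      x ≠ 0 ∧ Algebra.trace K L (a * x + b * x⁻¹) = 0).card + (22 * Fintype.card K + 6) * Q +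
        4 * Fintype.card K := by
  have h2L : (2 : L) ≠ 0 := by
    rw [show (2 : L) = algebraMap K L 2 from (map_ofNat _ 2).symm]
    exact (_root_.map_ne_zero _).mpr h2
  have hr0 : ((Fintype.card K : ℕ) : L) = 0 := by
    rw [← map_natCast (algebraMap K L), Nat.cast_card_eq_zero, map_zero]
  refine (card_artinSchreier_ge h2L a b ha hb _ Q Fintype.one_lt_card hr0 hQ hQr).trans ?_
  refine Nat.add_le_add_right (Nat.add_le_add_right ?_ _) _
  refine Finset.card_le_mul_card_image_of_maps_to (f := Prod.fst) ?_ _ ?_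
  · rintro ⟨x, y⟩ hz
    have hz' := (Finset.mem_filter.mp hz).2
    refine Finset.mem_filter.mpr ⟨Finset.mem_univ _, hz'.1, ?_⟩
    rw [hz'.2, map_sub, trace_pow_card, sub_self]
  · intro x _
    have hdeg : (X ^ Fintype.card K - X - C (a * x + b * x⁻¹) : L[X]).natDegree =
        Fintype.card K := by
      rw [natDegree_sub_C, FiniteField.X_pow_card_sub_X_natDegree_eq L Fintype.one_lt_card]
    have hne : (X ^ Fintype.card K - X - C (a * x + b * x⁻¹) : L[X]) ≠ 0 := by
      intro h
      rw [h, natDegree_zero] at hdeg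
      exact Fintype.card_ne_zero hdeg.symm
    refine le_trans ?_ (((Multiset.toFinset_card_le _).trans (card_roots' _)).trans hdeg.le)
    refine Finset.card_le_card_of_injOn Prod.snd ?_ ?_
    · rintro ⟨x', y⟩ hz
      have hz' := Finset.mem_filter.mp (Finset.mem_coe.mp hz)
      have h1 := (Finset.mem_filter.mp hz'.1).2
      have h3 : x' = x := hz'.2
      subst h3
      rw [Finset.mem_coe, Multiset.mem_toFinset, mem_roots hne]
      simp only [IsRoot.def, eval_sub, eval_pow, eval_X, eval_C]
      rw [h1.2, sub_self]
    · rintro ⟨x1, y1⟩ h1 ⟨x2, y2⟩ h2 h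
      have e1 := (Finset.mem_filter.mp (Finset.mem_coe.mp h1)).2
      have e2 := (Finset.mem_filter.mp (Finset.mem_coe.mp h2)).2
      exact Prod.ext (e1.trans e2.symm) h

end PointCount

section LFunction

open Polynomial

/-- The completely multiplicative weight on monic polynomials attached to `x ↦ ψ (a x + b / x)`. -/
noncomputable def kloostermanWeight {K : Type*} [Field K] (ψ : AddChar K ℂ) (a b : K) (h : K[X]) :
    ℂ :=
  if h.coeff 0 = 0 then 0 else ψ (-(a * h.nextCoeff + b * (h.coeff 1 / h.coeff 0)))

theorem kloostermanWeight_one {K : Type*} [Field K] (ψ : AddChar K ℂ) (a b : K) :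
    kloostermanWeight ψ a b 1 = 1 := by
  have : (1 : K[X]).nextCoeff = 0 := by rw [← C_1, nextCoeff_C_eq_zero]
  simp [kloostermanWeight, this, coeff_one]

theorem kloostermanWeight_mul {K : Type*} [Field K] (ψ : AddChar K ℂ) (a b : K) {g h : K[X]}
    (hg : g.Monic) (hh : h.Monic) :
    kloostermanWeight ψ a b (g * h) = kloostermanWeight ψ a b g * kloostermanWeight ψ a b h := by
  unfold kloostermanWeight
  rw [mul_coeff_zero, mul_coeff_one, hg.nextCoeff_mul hh]
  by_cases h1 : g.coeff 0 = 0
  · simp [h1]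
  by_cases h2 : h.coeff 0 = 0
  · simp [h2]
  rw [if_neg (mul_ne_zero h1 h2), if_neg h1, if_neg h2, ← AddChar.map_add_eq_mul]
  congr 1
  field_simp
  ring

theorem kloostermanWeight_pow {K : Type*} [Field K] (ψ : AddChar K ℂ) (a b : K) {g : K[X]}
    (hg : g.Monic) (j : ℕ) :
    kloostermanWeight ψ a b (g ^ j) = kloostermanWeight ψ a b g ^ j := by
  induction j with
  | zero => simp [kloostermanWeight_one]
  | succ j ih => rw [pow_succ, kloostermanWeight_mul ψ a b (hg.pow j) hg, ih, pow_succ]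

theorem finite_monic_natDegree_eq (K : Type*) [Field K] [Finite K] (d : ℕ) :
    {h : K[X] | h.Monic ∧ h.natDegree = d}.Finite := by
  have : Finite (degreeLT K d) := Finite.of_equiv _ (degreeLTEquiv K d).toEquiv.symm
  exact Finite.of_equiv _ (monicEquivDegreeLT (R := K) d).symm

/-- The monic polynomials of degree `d` over a finite field. -/
noncomputable def monicsOfDegree (K : Type*) [Field K] [Finite K] (d : ℕ) : Finset K[X] :=
  (finite_monic_natDegree_eq K d).toFinset

theorem mem_monicsOfDegree {K : Type*} [Field K] [Finite K] {d : ℕ} {h : K[X]} :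
    h ∈ monicsOfDegree K d ↔ h.Monic ∧ h.natDegree = d := by
  simp [monicsOfDegree]

/-- The monic irreducible polynomials of degree at most `d` over a finite field. -/
noncomputable def monicIrreducibles (K : Type*) [Field K] [Finite K] (d : ℕ) : Finset K[X] :=
  ((Finset.range (d + 1)).biUnion (monicsOfDegree K)).filter Irreducible

theorem mem_monicIrreducibles {K : Type*} [Field K] [Finite K] {d : ℕ} {P : K[X]} :
    P ∈ monicIrreducibles K d ↔ P.Monic ∧ Irreducible P ∧ P.natDegree ≤ d := by
  simp only [monicIrreducibles, Finset.mem_filter, Finset.mem_biUnion, Finset.mem_range,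
    mem_monicsOfDegree]
  constructor
  · rintro ⟨⟨i, hi, hm, hd⟩, hirr⟩
    exact ⟨hm, hirr, by omega⟩
  · rintro ⟨hm, hirr, hd⟩
    exact ⟨⟨_, by omega, hm, rfl⟩, hirr⟩

/-- The sum of the Kloosterman weight over the monic polynomials of degree `d`, a coefficient of
the associated `L`-function. -/
noncomputable def weightSum {K : Type*} [Field K] [Finite K] (ψ : AddChar K ℂ) (a b : K) (d : ℕ) :
    ℂ :=
  ∑ h ∈ monicsOfDegree K d, kloostermanWeight ψ a b h

theorem weightSum_zero {K : Type*} [Field K] [Finite K] (ψ : AddChar K ℂ) (a b : K) :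
    weightSum ψ a b 0 = 1 := by
  have : monicsOfDegree K 0 = {1} := by
    ext h
    rw [mem_monicsOfDegree, Finset.mem_singleton]
    constructor
    · rintro ⟨hm, hd⟩
      exact eq_one_of_monic_natDegree_zero hm hd
    · rintro rfl
      simp
  rw [weightSum, this, Finset.sum_singleton, kloostermanWeight_one]

theorem weightSum_eq_zero {K : Type*} [Field K] [Finite K] (ψ : AddChar K ℂ) (hψ : ψ ≠ 1) (a b : K)
    (ha : a ≠ 0) (d : ℕ) (hd : 3 ≤ d) : weightSum ψ a b d = 0 := by
  obtain ⟨t, ht⟩ := (AddChar.ne_one_iff).mp hψ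
  set u : K := -t / a with hu
  have key : ∀ h ∈ monicsOfDegree K d, ∀ v : K, (h + C v * X ^ (d - 1)) ∈ monicsOfDegree K d ∧
      kloostermanWeight ψ a b (h + C v * X ^ (d - 1)) =
        ψ (-(a * v)) * kloostermanWeight ψ a b h := by
    intro h hh v
    obtain ⟨hm, hdeg⟩ := mem_monicsOfDegree.mp hh
    have hlt : (C v * X ^ (d - 1) : K[X]).degree < h.degree := by
      rw [degree_eq_natDegree hm.ne_zero, hdeg]
      refine (degree_C_mul_X_pow_le _ _).trans_lt ?_
      exact_mod_cast (by omega : d - 1 < d)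
    have hnd : (h + C v * X ^ (d - 1)).natDegree = d := by
      rw [natDegree_add_eq_left_of_degree_lt hlt, hdeg]
    refine ⟨mem_monicsOfDegree.mpr ⟨hm.add_of_left hlt, hnd⟩, ?_⟩
    have h0 : (h + C v * X ^ (d - 1)).coeff 0 = h.coeff 0 := by
      rw [coeff_add, coeff_C_mul, coeff_X_pow, if_neg (by omega)]; simp
    have h1 : (h + C v * X ^ (d - 1)).coeff 1 = h.coeff 1 := by
      rw [coeff_add, coeff_C_mul, coeff_X_pow, if_neg (by omega)]; simp
    have hn : (h + C v * X ^ (d - 1)).nextCoeff = h.nextCoeff + v := by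
      rw [nextCoeff_of_natDegree_pos (by omega), nextCoeff_of_natDegree_pos (by omega), hnd, hdeg,
        coeff_add, coeff_C_mul, coeff_X_pow, if_pos rfl, mul_one]
    unfold kloostermanWeight
    rw [h0, h1, hn]
    split_ifs
    · simp
    · rw [← AddChar.map_add_eq_mul]
      congr 1
      ring
  have h1 : weightSum ψ a b d = ψ (-(a * u)) * weightSum ψ a b d := by
    unfold weightSum
    rw [Finset.mul_sum]
    symm
    refine Finset.sum_bij' (fun h _ => h + C u * X ^ (d - 1)) (fun h _ => h + C (-u) * X ^ (d - 1))
      (fun h hh => (key h hh u).1) (fun h hh => (key h hh (-u)).1) ?_ ?_ ?_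
    · intro h _; simp
    · intro h _; simp
    · intro h hh; exact (key h hh u).2.symm
  have h2 : -(a * u) = t := by rw [hu]; field_simp
  rw [h2] at h1
  have h3 : (ψ t - 1) * weightSum ψ a b d = 0 := by linear_combination -h1
  exact (mul_eq_zero.mp h3).resolve_left (sub_ne_zero.mpr ht)

theorem weightSum_two {K : Type*} [Field K] [Fintype K] (ψ : AddChar K ℂ) (hψ : ψ ≠ 1) (a b : K)
    (ha : a ≠ 0) (hb : b ≠ 0) : weightSum ψ a b 2 = Fintype.card K := by
  have hprim : ψ.IsPrimitive := AddChar.IsPrimitive.of_ne_one hψ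
  have h1 : weightSum ψ a b 2 = ∑ v : K, ∑ u : K,
      if v = 0 then 0 else ψ (u * (-(a + b / v))) := by
    rw [← Finset.sum_product', weightSum]
    have hnd : ∀ z : K × K, (X ^ 2 + C z.2 * X + C z.1 : K[X]).natDegree = 2 := fun z => by
      compute_degree!
    have hc0 : ∀ z : K × K, (X ^ 2 + C z.2 * X + C z.1 : K[X]).coeff 0 = z.1 := fun z => by
      simp
    have hc1 : ∀ z : K × K, (X ^ 2 + C z.2 * X + C z.1 : K[X]).coeff 1 = z.2 := fun z => by
      simp [coeff_X_pow, coeff_C]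
    symm
    refine Finset.sum_bij' (fun z _ => X ^ 2 + C z.2 * X + C z.1)
      (fun h _ => (h.coeff 0, h.coeff 1)) ?_ ?_ ?_ ?_ ?_
    · intro z _
      refine mem_monicsOfDegree.mpr ⟨?_, hnd z⟩
      monicity!
    · intro h _; simp
    · intro z _; rw [hc0, hc1]
    · intro h hh
      obtain ⟨hm, hd⟩ := mem_monicsOfDegree.mp hh
      have := hm.as_sum
      rw [hd] at this
      rw [Finset.sum_range_succ, Finset.sum_range_one] at this
      conv_rhs => rw [this]
      simp; ring
    · intro z _
      unfold kloostermanWeight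
      rw [hc0, nextCoeff_of_natDegree_pos (by rw [hnd]; norm_num), hnd, hc1]
      split_ifs
      · rfl
      · congr 1; ring
  have h2 : ∀ v : K, (∑ u : K, if v = 0 then (0 : ℂ) else ψ (u * (-(a + b / v)))) =
      if v = -b / a then (Fintype.card K : ℂ) else 0 := by
    intro v
    by_cases hv : v = 0
    · subst hv
      have : (0 : K) ≠ -b / a := by
        symm; exact div_ne_zero (neg_ne_zero.mpr hb) ha
      simp [this]
    · simp only [if_neg hv]
      rw [AddChar.sum_mulShift _ hprim]
      have : -(a + b / v) = 0 ↔ v = -b / a := by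
        rw [neg_eq_zero, eq_div_iff ha]
        constructor
        · intro h
          field_simp at h
          linear_combination h
        · intro h
          field_simp
          linear_combination h
      simp only [this]
      push_cast
      rfl
  rw [h1, Finset.sum_congr rfl fun v _ => h2 v]
  simp

end LFunction

section LFunction

open Polynomial IntermediateField

theorem trace_eq_smul_nextCoeff {K L : Type*} [Field K] [Field L] [Algebra K L]
    [FiniteDimensional K L] (x : L) :
    Algebra.trace K L x = (Module.finrank K L / (minpoly K x).natDegree) •
      (-(minpoly K x).nextCoeff) := by
  have hx : IsIntegral K x := IsIntegral.of_finite K x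
  rw [trace_eq_trace_adjoin, trace_adjoinSimpleGen hx, ← adjoin.finrank hx,
    ← Module.finrank_mul_finrank K K⟮x⟯ L, Nat.mul_div_cancel_left _ Module.finrank_pos]

theorem natDegree_minpoly_inv {K L : Type*} [Field K] [Field L] [Algebra K L]
    [FiniteDimensional K L] (x : L) : (minpoly K x⁻¹).natDegree = (minpoly K x).natDegree := by
  have h : K⟮x⁻¹⟯ = K⟮x⟯ := by
    apply le_antisymm
    · rw [adjoin_simple_le_iff]
      exact inv_mem (mem_adjoin_simple_self K x)
    · rw [adjoin_simple_le_iff]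
      have := inv_mem (mem_adjoin_simple_self K x⁻¹)
      rwa [inv_inv] at this
  rw [← adjoin.finrank (IsIntegral.of_finite K x⁻¹), ← adjoin.finrank (IsIntegral.of_finite K x), h]

theorem nextCoeff_minpoly_inv {K L : Type*} [Field K] [Field L] [Algebra K L]
    [FiniteDimensional K L] (x : L) (hx : x ≠ 0) :
    (minpoly K x⁻¹).nextCoeff = (minpoly K x).coeff 1 / (minpoly K x).coeff 0 := by
  set P := minpoly K x with hP
  have hint : IsIntegral K x := IsIntegral.of_finite K x
  have h0 : P.coeff 0 ≠ 0 := minpoly.coeff_zero_ne_zero hint hx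
  have hdegpos : 0 < P.natDegree := minpoly.natDegree_pos hint
  have hrevdeg : P.reverse.natDegree = P.natDegree := by
    rw [reverse_natDegree, natTrailingDegree_eq_zero.mpr (Or.inr h0), Nat.sub_zero]
  have hrevlead : P.reverse.leadingCoeff = P.coeff 0 := by
    rw [leadingCoeff, hrevdeg, coeff_reverse, revAt_le le_rfl, Nat.sub_self]
  have hmonic : (C (P.coeff 0)⁻¹ * P.reverse).Monic := by
    rw [Monic, leadingCoeff_mul, leadingCoeff_C, hrevlead, inv_mul_cancel₀ h0]
  have hnd : (C (P.coeff 0)⁻¹ * P.reverse).natDegree = P.natDegree := by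
    rw [natDegree_C_mul (inv_ne_zero h0), hrevdeg]
  have hroot : aeval x⁻¹ (C (P.coeff 0)⁻¹ * P.reverse) = 0 := by
    let _ := invertibleOfNonzero hx
    have h1 := eval₂_reverse_mul_pow (algebraMap K L) x P
    have h2 : eval₂ (algebraMap K L) x P = 0 := minpoly.aeval K x
    rw [h2, invOf_eq_inv] at h1
    have h3 := (mul_eq_zero.mp h1).resolve_right (pow_ne_zero _ hx)
    rw [map_mul, aeval_def x⁻¹ P.reverse, h3, mul_zero]
  have heq : C (P.coeff 0)⁻¹ * P.reverse = minpoly K x⁻¹ := by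
    refine minpoly.unique K x⁻¹ hmonic hroot fun q hq hq0 => ?_
    have h1 := natDegree_le_natDegree (minpoly.min K x⁻¹ hq hq0)
    rw [natDegree_minpoly_inv, ← hP] at h1
    rw [degree_eq_natDegree hmonic.ne_zero, degree_eq_natDegree hq.ne_zero, hnd]
    exact_mod_cast h1
  rw [← heq, nextCoeff_of_natDegree_pos (by omega), hnd, coeff_C_mul, coeff_reverse,
    revAt_le (by omega), Nat.sub_sub_self hdegpos]
  field_simp

theorem addChar_trace_eq_weight_pow {K L : Type*} [Field K] [Field L] [Algebra K L]
    [FiniteDimensional K L] (ψ : AddChar K ℂ) (a b : K) (x : L) (hx : x ≠ 0) :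
    ψ (Algebra.trace K L (algebraMap K L a * x + algebraMap K L b * x⁻¹)) =
      kloostermanWeight ψ a b (minpoly K x) ^
        (Module.finrank K L / (minpoly K x).natDegree) := by
  have hint : IsIntegral K x := IsIntegral.of_finite K x
  rw [kloostermanWeight, if_neg (minpoly.coeff_zero_ne_zero hint hx), ← AddChar.map_nsmul_eq_pow]
  congr 1
  rw [map_add, ← Algebra.smul_def, ← Algebra.smul_def, map_smul, map_smul,
    trace_eq_smul_nextCoeff x, trace_eq_smul_nextCoeff x⁻¹, natDegree_minpoly_inv,
    nextCoeff_minpoly_inv x hx]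
  simp only [smul_eq_mul, nsmul_eq_mul]
  ring

theorem card_minpoly_eq {K L : Type*} [Field K] [Fintype K] [Field L] [Fintype L] [Algebra K L]
    (P : K[X]) (hm : P.Monic) (hP : Irreducible P) :
    (Finset.univ.filter fun x : L => minpoly K x = P).card =
      if P.natDegree ∣ Module.finrank K L then P.natDegree else 0 := by
  split_ifs with hdvd
  · have h1 := (hP.natDegree_dvd_iff_dvd_X_pow_card_pow_sub_X).mp hdvd
    rw [Nat.card_eq_fintype_card, ← Module.card_eq_pow_finrank (K := K) (V := L)] at h1
    have hsplit : (P.map (algebraMap K L)).Splits := by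
      have h2 := (FiniteField.isSplittingField_sub L K).splits
      refine h2.of_dvd ?_ (Polynomial.map_dvd _ h1)
      rw [Polynomial.map_ne_zero_iff (algebraMap K L).injective]
      exact FiniteField.X_pow_card_sub_X_ne_zero K (p := Fintype.card L) Fintype.one_lt_card
    rw [← card_rootSet_eq_natDegree (PerfectField.separable_of_irreducible hP) hsplit,
      ← Set.toFinset_card]
    congr 1
    ext x
    rw [Finset.mem_filter, Set.mem_toFinset, mem_rootSet]
    constructor
    · rintro ⟨_, rfl⟩
      exact ⟨hm.ne_zero, minpoly.aeval K x⟩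
    · rintro ⟨_, h⟩
      exact ⟨Finset.mem_univ _, (minpoly.eq_of_irreducible_of_monic hP h hm).symm⟩
  · rw [Finset.card_eq_zero, Finset.filter_eq_empty_iff]
    rintro x _ rfl
    exact hdvd (minpoly.degree_dvd (IsIntegral.of_finite K x))

/-- The Kloosterman sum over a finite extension `L` of a finite field `K`. -/
noncomputable def extensionSum {K : Type*} [Field K] (L : Type*) [Field L] [Fintype L] [Algebra K L]
    (ψ : AddChar K ℂ) (a b : K) : ℂ :=
  ∑ x : L, if x = 0 then 0 else
    ψ (Algebra.trace K L (algebraMap K L a * x + algebraMap K L b * x⁻¹))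

theorem extensionSum_eq_sum_irreducibles {K L : Type*} [Field K] [Fintype K] [Field L] [Fintype L]
    [Algebra K L] (ψ : AddChar K ℂ) (a b : K) (d : ℕ) (hd : Module.finrank K L ≤ d) :
    extensionSum L ψ a b = ∑ P ∈ monicIrreducibles K d, ∑ j ∈ Finset.Icc 1 d,
      if j * P.natDegree = Module.finrank K L then
        (P.natDegree : ℂ) * kloostermanWeight ψ a b P ^ j else 0 := by
  set k := Module.finrank K L with hk
  have hkpos : 0 < k := Module.finrank_pos
  have hmaps : ∀ x ∈ (Finset.univ : Finset L), minpoly K x ∈ monicIrreducibles K d := fun x _ => by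
    have hint := IsIntegral.of_finite K x
    refine mem_monicIrreducibles.mpr ⟨minpoly.monic hint, minpoly.irreducible hint, ?_⟩
    exact (Nat.le_of_dvd hkpos (minpoly.degree_dvd hint)).trans hd
  rw [extensionSum, ← Finset.sum_fiberwise_of_maps_to hmaps]
  refine Finset.sum_congr rfl fun P hP => ?_
  obtain ⟨hm, hirr, hPd⟩ := mem_monicIrreducibles.mp hP
  have hpos : 0 < P.natDegree := hirr.natDegree_pos
  have h1 : ∀ x ∈ Finset.univ.filter (fun x : L => minpoly K x = P),
      (if x = 0 then 0 else ψ (Algebra.trace K L (algebraMap K L a * x + algebraMap K L b * x⁻¹)))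
        = kloostermanWeight ψ a b P ^ (k / P.natDegree) := by
    intro x hx
    have hxP : minpoly K x = P := (Finset.mem_filter.mp hx).2
    by_cases h0 : x = 0
    · rw [if_pos h0]
      have hw : kloostermanWeight ψ a b P = 0 := by
        rw [kloostermanWeight, if_pos]
        rw [← hxP, h0, minpoly.zero, coeff_X_zero]
      have hdvd : P.natDegree ∣ k := hxP ▸ minpoly.degree_dvd (IsIntegral.of_finite K x)
      rw [hw, zero_pow (Nat.div_pos (Nat.le_of_dvd hkpos hdvd) hpos).ne']
    · rw [if_neg h0, addChar_trace_eq_weight_pow ψ a b x h0, hxP]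
  rw [Finset.sum_congr rfl h1, Finset.sum_const, card_minpoly_eq P hm hirr, ← hk]
  split_ifs with hdvd
  · obtain ⟨j, hj⟩ := hdvd
    have hjpos : 0 < j := Nat.pos_of_mul_pos_left (hj ▸ hkpos)
    rw [Finset.sum_eq_single j]
    · rw [if_pos (by rw [hj, mul_comm]), hj, Nat.mul_div_cancel_left _ hpos, nsmul_eq_mul]
    · intro i _ hij
      rw [if_neg]
      intro h
      apply hij
      rw [hj, mul_comm] at h
      exact Nat.eq_of_mul_eq_mul_left hpos h
    · intro hnot
      exfalso
      apply hnot
      rw [Finset.mem_Icc]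
      refine ⟨hjpos, le_trans ?_ hd⟩
      rw [hj]
      exact Nat.le_mul_of_pos_left _ hpos
  · rw [zero_smul]
    symm
    refine Finset.sum_eq_zero fun j _ => if_neg fun h => hdvd ⟨j, by rw [← h, mul_comm]⟩

end LFunction

section LFunction

open Polynomial UniqueFactorizationMonoid

theorem sum_natDegree_of_pow_dvd {K : Type*} [Field K] [Finite K] {h : K[X]} (hm : h.Monic) :
    ∑ P ∈ monicIrreducibles K h.natDegree, ∑ j ∈ Finset.Icc 1 h.natDegree,
      (if P ^ j ∣ h then P.natDegree else 0) = h.natDegree := by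
  set d := h.natDegree with hd
  have hmon : ∀ P ∈ normalizedFactors h, P.Monic ∧ Irreducible P ∧ P.natDegree ≤ d := by
    intro P hP
    have hirr := irreducible_of_normalized_factor P hP
    refine ⟨?_, hirr, natDegree_le_of_dvd (dvd_of_mem_normalizedFactors hP) hm.ne_zero⟩
    rw [← normalize_normalized_factor P hP]
    exact monic_normalize hirr.ne_zero
  have hprod : (normalizedFactors h).prod = h := by
    rw [prod_normalizedFactors_eq hm.ne_zero, hm.normalize_eq_self]
  have hsum : ((normalizedFactors h).map natDegree).sum = d := by
    rw [← natDegree_multiset_prod_of_monic _ fun P hP => (hmon P hP).1, hprod]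
  have hcount : ∀ P ∈ monicIrreducibles K d, ∑ j ∈ Finset.Icc 1 d,
      (if P ^ j ∣ h then P.natDegree else 0) = (normalizedFactors h).count P * P.natDegree := by
    intro P hP
    obtain ⟨hPm, hPi, hPd⟩ := mem_monicIrreducibles.mp hP
    have hiff : ∀ j, P ^ j ∣ h ↔ j ≤ (normalizedFactors h).count P := by
      intro j
      rw [pow_dvd_iff_le_emultiplicity, emultiplicity_eq_count_normalizedFactors hPi hm.ne_zero,
        hPm.normalize_eq_self]
      exact_mod_cast Iff.rfl
    have hle : (normalizedFactors h).count P ≤ d := by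
      have h1 := natDegree_le_of_dvd ((hiff _).mpr le_rfl) hm.ne_zero
      rw [natDegree_pow] at h1
      exact (Nat.le_mul_of_pos_right _ hPi.natDegree_pos).trans h1
    rw [← Finset.sum_filter, Finset.sum_const, smul_eq_mul]
    congr 1
    have : (Finset.Icc 1 d).filter (fun j => P ^ j ∣ h) =
        Finset.Icc 1 ((normalizedFactors h).count P) := by
      ext j
      rw [Finset.mem_filter, hiff, Finset.mem_Icc, Finset.mem_Icc]
      omega
    rw [this, Nat.card_Icc, Nat.add_sub_cancel]
  rw [Finset.sum_congr rfl hcount]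
  rw [Finset.sum_multiset_map_count] at hsum
  simp only [smul_eq_mul] at hsum
  refine (Eq.trans ?_ hsum)
  symm
  refine Finset.sum_subset (fun P hP => ?_) fun P _ hP => ?_
  · exact mem_monicIrreducibles.mpr (hmon P (Multiset.mem_toFinset.mp hP))
  · rw [Multiset.count_eq_zero_of_notMem fun h => hP (Multiset.mem_toFinset.mpr h), zero_mul]

theorem sum_weight_of_pow_dvd {K : Type*} [Field K] [Finite K] (ψ : AddChar K ℂ) (a b : K)
    {P : K[X]} (hP : P.Monic) (j d : ℕ) :
    ∑ h ∈ monicsOfDegree K d, (if P ^ j ∣ h then kloostermanWeight ψ a b h else 0) =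
      if j * P.natDegree ≤ d then
        kloostermanWeight ψ a b P ^ j * weightSum ψ a b (d - j * P.natDegree) else 0 := by
  have hPj : (P ^ j).Monic := hP.pow j
  have hdeg : (P ^ j).natDegree = j * P.natDegree := natDegree_pow P j
  split_ifs with hle
  · rw [← Finset.sum_filter, weightSum, Finset.mul_sum]
    symm
    refine Finset.sum_bij (fun g _ => P ^ j * g) ?_ ?_ ?_ ?_
    · intro g hg
      obtain ⟨hgm, hgd⟩ := mem_monicsOfDegree.mp hg
      refine Finset.mem_filter.mpr ⟨mem_monicsOfDegree.mpr ⟨hPj.mul hgm, ?_⟩, dvd_mul_right _ _⟩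
      rw [hPj.natDegree_mul hgm, hdeg, hgd]
      omega
    · intro g _ g' _ h
      exact mul_left_cancel₀ hPj.ne_zero h
    · intro h hh
      obtain ⟨hh1, g, rfl⟩ := Finset.mem_filter.mp hh
      obtain ⟨hm, hd⟩ := mem_monicsOfDegree.mp hh1
      have hgm : g.Monic := hPj.of_mul_monic_left hm
      refine ⟨g, mem_monicsOfDegree.mpr ⟨hgm, ?_⟩, rfl⟩
      rw [hPj.natDegree_mul hgm, hdeg] at hd
      omega
    · intro g hg
      rw [kloostermanWeight_mul ψ a b hPj (mem_monicsOfDegree.mp hg).1,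
        kloostermanWeight_pow ψ a b hP]
  · refine Finset.sum_eq_zero fun h hh => if_neg fun hdvd => hle ?_
    obtain ⟨hm, hd⟩ := mem_monicsOfDegree.mp hh
    rw [← hdeg, ← hd]
    exact natDegree_le_of_dvd hdvd hm.ne_zero

/-- The sum over powers of irreducible polynomials of total degree `k` which expresses the
Kloosterman sum over the extension of degree `k`. -/
noncomputable def primePowerSum {K : Type*} [Field K] [Finite K] (ψ : AddChar K ℂ) (a b : K)
    (k : ℕ) : ℂ :=
  ∑ P ∈ monicIrreducibles K k, ∑ j ∈ Finset.Icc 1 k,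
    if j * P.natDegree = k then (P.natDegree : ℂ) * kloostermanWeight ψ a b P ^ j else 0

theorem primePowerSum_eq_of_le {K : Type*} [Field K] [Finite K] (ψ : AddChar K ℂ) (a b : K)
    {k d : ℕ} (hk : 1 ≤ k) (hkd : k ≤ d) :
    primePowerSum ψ a b k = ∑ P ∈ monicIrreducibles K d, ∑ j ∈ Finset.Icc 1 d,
      if j * P.natDegree = k then (P.natDegree : ℂ) * kloostermanWeight ψ a b P ^ j else 0 := by
  rw [primePowerSum]
  have h1 : ∀ P ∈ monicIrreducibles K d, (∑ j ∈ Finset.Icc 1 d,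
      if j * P.natDegree = k then (P.natDegree : ℂ) * kloostermanWeight ψ a b P ^ j else 0) =
      ∑ j ∈ Finset.Icc 1 k,
      if j * P.natDegree = k then (P.natDegree : ℂ) * kloostermanWeight ψ a b P ^ j else 0 := by
    intro P hP
    symm
    refine Finset.sum_subset (Finset.Icc_subset_Icc_right hkd) fun j _ hj2 => if_neg fun h => ?_
    apply hj2
    have hpos := (mem_monicIrreducibles.mp hP).2.1.natDegree_pos
    rw [Finset.mem_Icc, ← h]
    refine ⟨Nat.pos_of_ne_zero ?_, Nat.le_mul_of_pos_right _ hpos⟩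
    rintro rfl
    omega
  rw [Finset.sum_congr rfl h1]
  refine Finset.sum_subset (fun P hP => ?_) fun P hP hP2 => ?_
  · obtain ⟨h1, h2, h3⟩ := mem_monicIrreducibles.mp hP
    exact mem_monicIrreducibles.mpr ⟨h1, h2, h3.trans hkd⟩
  · obtain ⟨h1, h2, h3⟩ := mem_monicIrreducibles.mp hP
    refine Finset.sum_eq_zero fun j hj => if_neg fun h => hP2 ?_
    refine mem_monicIrreducibles.mpr ⟨h1, h2, ?_⟩
    rw [← h]
    exact Nat.le_mul_of_pos_left _ (Finset.mem_Icc.mp hj).1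

theorem extensionSum_eq_primePowerSum {K L : Type*} [Field K] [Fintype K] [Field L] [Fintype L]
    [Algebra K L] (ψ : AddChar K ℂ) (a b : K) :
    extensionSum L ψ a b = primePowerSum ψ a b (Module.finrank K L) :=
  extensionSum_eq_sum_irreducibles ψ a b _ le_rfl

/-- Newton's identity relating the coefficients of the `L`-function and of its logarithmic
derivative. -/
theorem natCast_mul_weightSum {K : Type*} [Field K] [Finite K] (ψ : AddChar K ℂ) (a b : K)
    (d : ℕ) :
    (d : ℂ) * weightSum ψ a b d =
      ∑ k ∈ Finset.Icc 1 d, primePowerSum ψ a b k * weightSum ψ a b (d - k) := by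
  have h1 : (d : ℂ) * weightSum ψ a b d = ∑ P ∈ monicIrreducibles K d, ∑ j ∈ Finset.Icc 1 d,
      (P.natDegree : ℂ) *
        ∑ h ∈ monicsOfDegree K d, (if P ^ j ∣ h then kloostermanWeight ψ a b h else 0) := by
    have h2 : ∀ h ∈ monicsOfDegree K d, (d : ℂ) * kloostermanWeight ψ a b h =
        ∑ P ∈ monicIrreducibles K d, ∑ j ∈ Finset.Icc 1 d,
          (P.natDegree : ℂ) * (if P ^ j ∣ h then kloostermanWeight ψ a b h else 0) := by
      intro h hh
      obtain ⟨hm, rfl⟩ := mem_monicsOfDegree.mp hh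
      have h3 := congrArg (Nat.cast (R := ℂ)) (sum_natDegree_of_pow_dvd hm)
      conv_lhs => rw [← h3]
      push_cast
      simp only [Finset.sum_mul]
      refine Finset.sum_congr rfl fun P _ => Finset.sum_congr rfl fun j _ => ?_
      split_ifs <;> simp
    rw [weightSum, Finset.mul_sum, Finset.sum_congr rfl h2, Finset.sum_comm]
    refine Finset.sum_congr rfl fun P _ => ?_
    rw [Finset.sum_comm]
    simp only [Finset.mul_sum]
  have h2 : ∀ k ∈ Finset.Icc 1 d, primePowerSum ψ a b k * weightSum ψ a b (d - k) =
      ∑ P ∈ monicIrreducibles K d, ∑ j ∈ Finset.Icc 1 d,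
        if j * P.natDegree = k then
          (P.natDegree : ℂ) * kloostermanWeight ψ a b P ^ j * weightSum ψ a b (d - k) else 0 := by
    intro k hk
    obtain ⟨hk1, hk2⟩ := Finset.mem_Icc.mp hk
    rw [primePowerSum_eq_of_le ψ a b hk1 hk2]
    simp only [Finset.sum_mul, ite_mul, zero_mul]
  rw [h1, Finset.sum_congr rfl h2]
  conv_rhs => rw [Finset.sum_comm]
  refine Finset.sum_congr rfl fun P hP => ?_
  conv_rhs => rw [Finset.sum_comm]
  refine Finset.sum_congr rfl fun j hj => ?_
  obtain ⟨hPm, hPi, -⟩ := mem_monicIrreducibles.mp hP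
  rw [sum_weight_of_pow_dvd ψ a b hPm, Finset.sum_ite_eq]
  have hpos : 1 ≤ j * P.natDegree := Nat.mul_pos (Finset.mem_Icc.mp hj).1 hPi.natDegree_pos
  by_cases hle : j * P.natDegree ≤ d
  · rw [if_pos hle, if_pos (Finset.mem_Icc.mpr ⟨hpos, hle⟩), mul_assoc]
  · rw [if_neg hle, if_neg fun h => hle (Finset.mem_Icc.mp h).2, mul_zero]

theorem primePowerSum_two {K : Type*} [Field K] [Fintype K] (ψ : AddChar K ℂ) (hψ : ψ ≠ 1)
    (a b : K) (ha : a ≠ 0) (hb : b ≠ 0) :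
    primePowerSum ψ a b 2 = 2 * Fintype.card K - primePowerSum ψ a b 1 ^ 2 := by
  have h1 := natCast_mul_weightSum ψ a b 1
  have h2 := natCast_mul_weightSum ψ a b 2
  rw [weightSum_two ψ hψ a b ha hb, Finset.sum_Icc_succ_top (by norm_num)] at h2
  simp [weightSum_zero] at h1 h2
  rw [h1] at h2
  linear_combination -h2

theorem primePowerSum_add_three {K : Type*} [Field K] [Fintype K] (ψ : AddChar K ℂ) (hψ : ψ ≠ 1)
    (a b : K) (ha : a ≠ 0) (hb : b ≠ 0) (n : ℕ) :
    primePowerSum ψ a b (n + 3) = -(primePowerSum ψ a b 1 * primePowerSum ψ a b (n + 2)) -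
      Fintype.card K * primePowerSum ψ a b (n + 1) := by
  have h1 := natCast_mul_weightSum ψ a b 1
  have h2 := natCast_mul_weightSum ψ a b (n + 3)
  rw [weightSum_eq_zero ψ hψ a b ha _ (by omega), Finset.sum_Icc_succ_top (by omega),
    Finset.sum_Icc_succ_top (by omega), Finset.sum_Icc_succ_top (by omega),
    Finset.sum_eq_zero] at h2
  · rw [Nat.sub_self, show n + 3 - (n + 2) = 1 by omega, show n + 3 - (n + 1) = 2 by omega,
      weightSum_two ψ hψ a b ha hb] at h2
    simp [weightSum_zero] at h1 h2
    rw [h1] at h2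
    linear_combination -h2
  · intro k hk
    obtain ⟨_, hk2⟩ := Finset.mem_Icc.mp hk
    rw [weightSum_eq_zero ψ hψ a b ha _ (by omega), mul_zero]

end LFunction

section WeilBound

theorem abs_le_of_linear_recurrence {w : ℕ → ℝ} {T p : ℝ} (hp : 0 < p) (h0 : w 0 = 2)
    (h1 : w 1 = T) (hrec : ∀ n, w (n + 2) = T * w (n + 1) - p ^ 2 * w n) (hT : |T| ≤ 2 * p)
    (n : ℕ) : |w n| ≤ 2 * p ^ n := by
  obtain ⟨hT1, hT2⟩ := abs_le.mp hT
  set θ := Real.arccos (T / (2 * p)) with hθ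
  have hcos : T = 2 * p * Real.cos θ := by
    rw [hθ, Real.cos_arccos]
    · field_simp
    · rw [le_div_iff₀ (by positivity)]; linarith
    · rw [div_le_iff₀ (by positivity)]; linarith
  have key : ∀ n : ℕ, w n = 2 * p ^ n * Real.cos (n * θ) ∧
      w (n + 1) = 2 * p ^ (n + 1) * Real.cos ((n + 1 : ℕ) * θ) := by
    intro n
    induction n with
    | zero => simp [h0, h1, hcos]
    | succ n ih =>
      refine ⟨ih.2, ?_⟩
      rw [hrec, ih.1, ih.2, hcos]
      have e1 : ((n + 1 + 1 : ℕ) : ℝ) * θ = ((n + 1 : ℕ) : ℝ) * θ + θ := by push_cast; ring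
      have e2 : (n : ℝ) * θ = ((n + 1 : ℕ) : ℝ) * θ - θ := by push_cast; ring
      rw [e1, e2, Real.cos_add, Real.cos_sub]
      ring
  rw [(key n).1, abs_mul, abs_of_pos (by positivity : 0 < 2 * p ^ n)]
  exact mul_le_of_le_one_right (by positivity) (Real.abs_cos_le_one _)
theorem le_of_linear_recurrence {w : ℕ → ℝ} {T p : ℝ} (hp : 0 < p) (h0 : w 0 = 2)
    (h1 : w 1 = T) (hrec : ∀ n, w (n + 2) = T * w (n + 1) - p ^ 2 * w n) (hT : 2 * p ≤ T)
    (n : ℕ) : 2 * (T / 2) ^ n ≤ w n := by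
  have hγ : p ≤ T / 2 := by linarith
  have key : ∀ n, 0 < w n ∧ T / 2 * w n ≤ w (n + 1) := by
    intro n
    induction n with
    | zero => rw [h0, h1]; constructor <;> linarith
    | succ n ih =>
      have hpos : 0 < w (n + 1) := lt_of_lt_of_le (mul_pos (by linarith) ih.1) ih.2
      refine ⟨hpos, ?_⟩
      rw [hrec]
      have h2 : p ^ 2 * w n ≤ T / 2 * w (n + 1) := by
        calc p ^ 2 * w n ≤ (T / 2) ^ 2 * w n := by gcongr; exact ih.1.le
          _ = T / 2 * (T / 2 * w n) := by ring
          _ ≤ T / 2 * w (n + 1) := by gcongr; linarith; exact ih.2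
      linarith
  induction n with
  | zero => rw [h0]; norm_num
  | succ n ih =>
    refine le_trans ?_ (key n).2
    rw [pow_succ]
    calc 2 * ((T / 2) ^ n * (T / 2)) = T / 2 * (2 * (T / 2) ^ n) := by ring
      _ ≤ T / 2 * w n := by gcongr; linarith
theorem conj_extensionSum {K L : Type*} [Field K] [Finite K] [Field L] [Fintype L] [Algebra K L]
    (ψ : AddChar K ℂ) (a b : K) :
    (starRingEnd ℂ) (extensionSum L ψ a b) = extensionSum L ψ a b := by
  rw [extensionSum, map_sum, ← Equiv.sum_comp (Equiv.neg L)]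
  refine Finset.sum_congr rfl fun x _ => ?_
  simp only [Equiv.neg_apply, neg_eq_zero]
  split_ifs with hx
  · simp
  · rw [← AddChar.map_neg_eq_conj, ← map_neg]
    congr 2
    rw [inv_neg]
    ring
theorem sum_extensionSum {K L : Type*} [Field K] [Fintype K] [Field L] [Fintype L] [Algebra K L]
    (ψ : AddChar K ℂ) (hψ : ψ ≠ 1) (a b : K) :
    ∑ c : K, extensionSum L ψ (c * a) (c * b) = Fintype.card K *
      ((Finset.univ.filter fun x : L => x ≠ 0 ∧
        Algebra.trace K L (algebraMap K L a * x + algebraMap K L b * x⁻¹) = 0).card : ℂ) := by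
  have hprim : ψ.IsPrimitive := AddChar.IsPrimitive.of_ne_one hψ
  simp only [extensionSum]
  rw [Finset.sum_comm, Finset.card_filter, Nat.cast_sum, Finset.mul_sum]
  refine Finset.sum_congr rfl fun x _ => ?_
  by_cases hx : x = 0
  · simp [hx]
  · have h1 : ∀ c : K, Algebra.trace K L (algebraMap K L (c * a) * x + algebraMap K L (c * b) * x⁻¹)
        = c * Algebra.trace K L (algebraMap K L a * x + algebraMap K L b * x⁻¹) := by
      intro c
      have h2 : algebraMap K L (c * a) * x + algebraMap K L (c * b) * x⁻¹ =
          c • (algebraMap K L a * x + algebraMap K L b * x⁻¹) := by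
        rw [Algebra.smul_def c, map_mul, map_mul]
        ring
      rw [h2, map_smul, smul_eq_mul]
    simp only [if_neg hx]
    rw [Finset.sum_congr rfl fun c _ => congrArg ψ (h1 c), AddChar.sum_mulShift _ hprim]
    simp only [ne_eq, hx, not_false_eq_true, true_and]
    split_ifs <;> simp
theorem extensionSum_zero_zero {K : Type*} (L : Type*) [Field K] [Field L] [Fintype L]
    [Algebra K L] (ψ : AddChar K ℂ) : extensionSum L ψ 0 0 = Fintype.card L - 1 := by
  simp only [extensionSum, map_zero, zero_mul, add_zero, AddChar.map_zero_eq_one]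
  have h : ∀ x : L, (if x = 0 then (0 : ℂ) else 1) = 1 - if x = 0 then 1 else 0 := fun x => by
    split_ifs <;> simp
  simp only [h, Finset.sum_sub_distrib]
  simp
theorem re_primePowerSum_even {p : ℕ} [Fact p.Prime] (ψ : AddChar (ZMod p) ℂ) (hψ : ψ ≠ 1)
    (a b : ZMod p) (ha : a ≠ 0) (hb : b ≠ 0) (r : ℝ) (hr : primePowerSum ψ a b 1 = r) :
    ∃ w : ℕ → ℝ, w 0 = 2 ∧ w 1 = r ^ 2 - 2 * p ∧
      (∀ n, w (n + 2) = (r ^ 2 - 2 * p) * w (n + 1) - (p : ℝ) ^ 2 * w n) ∧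
      ∀ n, 1 ≤ n → w n = -(primePowerSum ψ a b (2 * n)).re := by
  have h2 := primePowerSum_two ψ hψ a b ha hb
  have h3 := primePowerSum_add_three ψ hψ a b ha hb
  rw [ZMod.card] at h2
  simp only [ZMod.card] at h3
  rw [hr] at h2 h3
  refine ⟨fun n => if n = 0 then 2 else -(primePowerSum ψ a b (2 * n)).re, by simp, ?_, ?_, ?_⟩
  · simp only [one_ne_zero, if_false, mul_one, h2]
    have : (2 * (p : ℂ) - (r : ℂ) ^ 2) = ((2 * p - r ^ 2 : ℝ) : ℂ) := by push_cast; ring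
    rw [this, Complex.ofReal_re]
    ring
  · intro n
    rcases Nat.eq_zero_or_pos n with rfl | hn
    · have e3 := h3 0
      have e4 := h3 1
      simp only [Nat.reduceAdd, zero_add, hr] at e3 e4
      simp only [zero_add, one_ne_zero, OfNat.ofNat_ne_zero, if_false, if_true, Nat.reduceMul,
        mul_one]
      rw [e4, e3, h2]
      have e5 : (-((r : ℂ) * (-((r : ℂ) * (2 * p - (r : ℂ) ^ 2)) - p * r)) -
          p * (2 * p - (r : ℂ) ^ 2)) = ((-(r * (-(r * (2 * p - r ^ 2)) - p * r)) -
          p * (2 * p - r ^ 2) : ℝ) : ℂ) := by push_cast; ring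
      have e6 : (2 * (p : ℂ) - (r : ℂ) ^ 2) = ((2 * p - r ^ 2 : ℝ) : ℂ) := by push_cast; ring
      rw [e5, e6, Complex.ofReal_re, Complex.ofReal_re]
      ring
    · obtain ⟨m, hm⟩ : ∃ m, 2 * n = m + 1 := ⟨2 * n - 1, by omega⟩
      have e2 := h3 m
      have e3 := h3 (m + 1)
      have e4 := h3 (m + 2)
      have e5 : primePowerSum ψ a b (2 * (n + 2)) =
          ((r ^ 2 - 2 * p : ℝ) : ℂ) * primePowerSum ψ a b (2 * (n + 1)) -
            (((p : ℝ) ^ 2 : ℝ) : ℂ) * primePowerSum ψ a b (2 * n) := by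
        rw [show 2 * (n + 2) = m + 2 + 3 by omega, show 2 * (n + 1) = m + 3 by omega, hm]
        push_cast
        linear_combination e4 - r * e3 + (p : ℂ) * e2
      have : n ≠ 0 := by omega
      simp only [this, Nat.add_eq_zero_iff, OfNat.ofNat_ne_zero, one_ne_zero, and_false, if_false]
      rw [e5, Complex.sub_re, Complex.re_ofReal_mul, Complex.re_ofReal_mul]
      ring
  · intro n hn
    simp only [show n ≠ 0 by omega, if_false]
theorem neg_sum_re_extensionSum_le {p : ℕ} [Fact p.Prime] (hp2 : p ≠ 2) (ψ : AddChar (ZMod p) ℂ)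
    (hψ : ψ ≠ 1) (a b : ZMod p) (ha : a ≠ 0) (hb : b ≠ 0) (l : ℕ) (hl : 8 * p + 4 ≤ p ^ l) :
    ∑ c ∈ Finset.univ.erase (0 : ZMod p), -(primePowerSum ψ (c * a) (c * b) (2 * l)).re ≤
      (26 * p + 6) * (p : ℝ) ^ l := by
  have hp : p.Prime := Fact.out
  have hl0 : l ≠ 0 := by
    rintro rfl
    simp at hl
  let L := GaloisField p (2 * l)
  have : Fintype L := Fintype.ofFinite L
  have hcard : Fintype.card L = (p ^ l) ^ 2 := by
    rw [← Nat.card_eq_fintype_card, GaloisField.card p _ (by omega), ← pow_mul, mul_comm]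
  have hrank : Module.finrank (ZMod p) L = 2 * l := GaloisField.finrank p (by omega)
  have h2 : (2 : ZMod p) ≠ 0 := by
    intro h
    have : ((2 : ℕ) : ZMod p) = 0 := by exact_mod_cast h
    rw [ZMod.natCast_eq_zero_iff] at this
    exact hp2 ((Nat.prime_dvd_prime_iff_eq hp Nat.prime_two).mp this)
  have hge := card_trace_eq_zero_ge (K := ZMod p) (L := L) h2 (algebraMap _ _ a) (algebraMap _ _ b)
    ((_root_.map_ne_zero _).mpr ha) ((_root_.map_ne_zero _).mpr hb) (p ^ l) hcard
    (by rw [ZMod.card]; exact hl)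
  have hsum := sum_extensionSum (L := L) ψ hψ a b
  rw [← Finset.add_sum_erase _ _ (Finset.mem_univ (0 : ZMod p)), zero_mul, zero_mul,
    extensionSum_zero_zero, hcard] at hsum
  rw [ZMod.card] at hge hsum
  have hre := congrArg Complex.re hsum
  have hL : ∀ c : ZMod p, extensionSum L ψ (c * a) (c * b) =
      primePowerSum ψ (c * a) (c * b) (2 * l) := by
    intro c
    rw [extensionSum_eq_primePowerSum, hrank]
  simp only [hL] at hre
  set N := (Finset.univ.filter fun x : L => x ≠ 0 ∧ Algebra.trace (ZMod p) L
    (algebraMap (ZMod p) L a * x + algebraMap (ZMod p) L b * x⁻¹) = 0).card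
  have hge' : (((p ^ l) ^ 2 : ℕ) : ℝ) ≤ p * N + (22 * p + 6) * (p : ℝ) ^ l + 4 * p := by
    exact_mod_cast hge
  have hre' : (((p ^ l) ^ 2 : ℕ) : ℝ) - 1 + ∑ c ∈ Finset.univ.erase (0 : ZMod p),
      (primePowerSum ψ (c * a) (c * b) (2 * l)).re = p * N := by
    rw [Complex.add_re, Complex.re_sum] at hre
    rw [← Nat.cast_mul, Complex.natCast_re, Complex.sub_re, Complex.natCast_re,
      Complex.one_re] at hre
    exact_mod_cast hre
  rw [Finset.sum_neg_distrib]
  have h1 : (1 : ℝ) ≤ (p : ℝ) ^ l := one_le_pow₀ (by exact_mod_cast hp.one_lt.le)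
  have h3 : (p : ℝ) ≤ p * (p : ℝ) ^ l := le_mul_of_one_le_right (by positivity) h1
  nlinarith
/-- **Weil's bound** for Kloosterman sums modulo an odd prime. -/
theorem norm_extensionSum_le {p : ℕ} [Fact p.Prime] (hp2 : p ≠ 2) (ψ : AddChar (ZMod p) ℂ)
    (hψ : ψ ≠ 1) (a b : ZMod p) (ha : a ≠ 0) (hb : b ≠ 0) :
    ‖extensionSum (ZMod p) ψ a b‖ ≤ 2 * Real.sqrt p := by
  have hp : p.Prime := Fact.out
  have hp0 : (0 : ℝ) < p := by exact_mod_cast hp.pos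
  have hreal : ∀ c : ZMod p, ∃ r : ℝ, extensionSum (ZMod p) ψ (c * a) (c * b) = r := fun c =>
    Complex.conj_eq_iff_real.mp (conj_extensionSum ψ _ _)
  choose r hr using hreal
  have hr' : ∀ c, primePowerSum ψ (c * a) (c * b) 1 = r c := fun c => by
    rw [← hr, extensionSum_eq_primePowerSum, Module.finrank_self]
  have hlow : ∀ c : ZMod p, c ≠ 0 → ∀ n, 1 ≤ n →
      -(2 * (p : ℝ) ^ n) ≤ -(primePowerSum ψ (c * a) (c * b) (2 * n)).re := by
    intro c hc n hn
    obtain ⟨w, h0, h1, hrec, hw⟩ := re_primePowerSum_even ψ hψ (c * a) (c * b)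
      (mul_ne_zero hc ha) (mul_ne_zero hc hb) (r c) (hr' c)
    rw [← hw n hn]
    rcases le_total (r c ^ 2 - 2 * (p : ℝ)) (2 * (p : ℝ)) with h | h
    · refine (abs_le.mp (abs_le_of_linear_recurrence hp0 h0 h1 hrec (abs_le.mpr ⟨?_, h⟩) n)).1
      nlinarith [sq_nonneg (r c)]
    · have h2 := le_of_linear_recurrence hp0 h0 h1 hrec h n
      have h3 : 0 ≤ 2 * ((r c ^ 2 - 2 * p) / 2) ^ n := by
        have : 0 ≤ (r c ^ 2 - 2 * p) / 2 := by linarith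
        positivity
      have h4 : (0 : ℝ) ≤ 2 * (p : ℝ) ^ n := by positivity
      linarith
  have hr1 := hr 1
  rw [one_mul, one_mul] at hr1
  rw [hr1, Complex.norm_real, Real.norm_eq_abs]
  by_contra! hlt
  have hsq : 4 * (p : ℝ) < r 1 ^ 2 := by
    have h1 := pow_lt_pow_left₀ hlt (by positivity) two_ne_zero
    rw [sq_abs, mul_pow, Real.sq_sqrt hp0.le] at h1
    linarith
  obtain ⟨w, h0, h1, hrec, hw⟩ := re_primePowerSum_even ψ hψ (1 * a) (1 * b)
      (mul_ne_zero one_ne_zero ha) (mul_ne_zero one_ne_zero hb) (r 1) (hr' 1)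
  set γ := (r 1 ^ 2 - 2 * p) / 2 with hγ
  have hγp : 1 < γ / p := by
    rw [one_lt_div hp0]
    linarith
  obtain ⟨n₀, hn₀⟩ := pow_unbounded_of_one_lt (28 * p + 6 : ℝ) hγp
  set l := n₀ + (8 * p + 4) with hl
  have hl2 : 8 * p + 4 ≤ p ^ l :=
    (by omega : 8 * p + 4 ≤ l).trans (Nat.lt_pow_self hp.one_lt).le
  have hup := neg_sum_re_extensionSum_le hp2 ψ hψ a b ha hb l hl2
  rw [← Finset.add_sum_erase _ _ (Finset.mem_erase.mpr ⟨one_ne_zero, Finset.mem_univ (1 : ZMod p)⟩),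
    ← hw l (by omega)] at hup
  have hw1 := le_of_linear_recurrence hp0 h0 h1 hrec (by linarith) l
  have hrest : -((p : ℝ) * (2 * (p : ℝ) ^ l)) ≤
      ∑ c ∈ (Finset.univ.erase (0 : ZMod p)).erase 1,
        -(primePowerSum ψ (c * a) (c * b) (2 * l)).re := by
    calc -((p : ℝ) * (2 * (p : ℝ) ^ l)) ≤
        ((Finset.univ.erase (0 : ZMod p)).erase 1).card • -(2 * (p : ℝ) ^ l) := by
          rw [nsmul_eq_mul, mul_neg, neg_le_neg_iff]
          gcongr
          have : ((Finset.univ.erase (0 : ZMod p)).erase 1).card ≤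
              (Finset.univ : Finset (ZMod p)).card :=
            Finset.card_le_card ((Finset.erase_subset _ _).trans (Finset.erase_subset _ _))
          rwa [Finset.card_univ, ZMod.card] at this
      _ ≤ _ := Finset.card_nsmul_le_sum _ _ _ fun c hc =>
          hlow c (Finset.mem_erase.mp (Finset.mem_erase.mp hc).2).1 l (by omega)
  have hbig : (28 * p + 6 : ℝ) * (p : ℝ) ^ l < γ ^ l := by
    rw [← lt_div_iff₀ (by positivity), ← div_pow]
    exact hn₀.trans_le (pow_le_pow_right₀ hγp.le (by omega))
  have : (0 : ℝ) < γ ^ l := by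
    refine pow_pos ?_ _
    linarith
  rw [← hγ] at hw1
  linarith

end WeilBound

section PrimePowers

/-- The unit `1 + z` when `z ^ 3 = 0`. -/
def oneAddUnit {R : Type*} [CommRing R] (z : R) (hz : z ^ 3 = 0) : Rˣ where
  val := 1 + z
  inv := 1 - z + z ^ 2
  val_inv := by linear_combination hz
  inv_val := by linear_combination hz
theorem addChar_mul_oneAddUnit {R : Type*} [CommRing R] (ψ : AddChar R ℂ) (h n z : R)
    (hz : z ^ 3 = 0) (u : Rˣ) :
    ψ (h * ((u * oneAddUnit z hz : Rˣ) : R) + n * ((u * oneAddUnit z hz)⁻¹ : Rˣ)) =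
      ψ (h * u + n * (u⁻¹ : Rˣ)) *
        ψ ((h * u - n * (u⁻¹ : Rˣ)) * z + n * (u⁻¹ : Rˣ) * z ^ 2) := by
  rw [← AddChar.map_add_eq_mul, mul_inv, Units.val_mul, Units.val_mul]
  congr 1
  have h1 : ((oneAddUnit z hz : Rˣ) : R) = 1 + z := rfl
  have h2 : (((oneAddUnit z hz)⁻¹ : Rˣ) : R) = 1 - z + z ^ 2 := rfl
  rw [h1, h2]
  ring
/-- The complete Kloosterman sum modulo `q`. -/
noncomputable def completeKloosterman (q : ℕ) [NeZero q] (h n : ZMod q) : ℂ :=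
  ∑ u : (ZMod q)ˣ, ZMod.stdAddChar (h * (u : ZMod q) + n * (↑u⁻¹ : ZMod q))
theorem sum_range_addChar_mul {q : ℕ} [NeZero q] (α : ZMod q) (M : ℕ) (hM : α * M = 0) :
    ∑ v ∈ Finset.range M, ZMod.stdAddChar (α * (v : ZMod q)) = if α = 0 then (M : ℂ) else 0 := by
  have h1 : ∀ v : ℕ, ZMod.stdAddChar (α * (v : ZMod q)) = ZMod.stdAddChar α ^ v := fun v => by
    rw [← AddChar.map_nsmul_eq_pow, nsmul_eq_mul, mul_comm]
  simp only [h1]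
  split_ifs with hα
  · simp [hα]
  · have hne : ZMod.stdAddChar α ≠ 1 := fun h => hα <| by
      rw [← AddChar.map_zero_eq_one (ZMod.stdAddChar (N := q))] at h
      exact ZMod.injective_stdAddChar h
    rw [geom_sum_eq hne, ← h1, hM, AddChar.map_zero_eq_one, sub_self, zero_div]
/-- The stationary phase points of a Kloosterman sum. -/
noncomputable def stationaryPoints {q : ℕ} [NeZero q] (h n s : ZMod q) : Finset (ZMod q)ˣ :=
  Finset.univ.filter fun u => s * (h * (u : ZMod q) - n * (↑u⁻¹ : ZMod q)) = 0
theorem completeKloosterman_eq_sum_stationaryPoints {q : ℕ} [NeZero q] (h n s : ZMod q) (M : ℕ)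
    (hM0 : M ≠ 0) (hM : s * M = 0) (hs : s ^ 2 = 0) :
    completeKloosterman q h n =
      ∑ u ∈ stationaryPoints h n s, ZMod.stdAddChar (h * (u : ZMod q) + n * (↑u⁻¹ : ZMod q)) := by
  have hz : ∀ v : ℕ, (s * v) ^ 3 = 0 := fun v => by
    rw [show (s * (v : ZMod q)) ^ 3 = s ^ 2 * (s * v ^ 3) by ring, hs, zero_mul]
  have h1 : ∀ v : ℕ, completeKloosterman q h n = ∑ u : (ZMod q)ˣ,
      ZMod.stdAddChar (h * (u : ZMod q) + n * (↑u⁻¹ : ZMod q)) *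
        ZMod.stdAddChar (s * (h * (u : ZMod q) - n * (↑u⁻¹ : ZMod q)) * (v : ZMod q)) := by
    intro v
    rw [completeKloosterman, ← Equiv.sum_comp (Equiv.mulRight (oneAddUnit _ (hz v)))]
    refine Finset.sum_congr rfl fun u _ => ?_
    rw [Equiv.coe_mulRight, addChar_mul_oneAddUnit]
    congr 2
    linear_combination (n * ((↑u⁻¹ : ZMod q) : ZMod q) * v ^ 2) * hs
  have h2 : (M : ℂ) * completeKloosterman q h n = (M : ℂ) *
      ∑ u ∈ stationaryPoints h n s, ZMod.stdAddChar (h * (u : ZMod q) + n * (↑u⁻¹ : ZMod q)) := by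
    calc (M : ℂ) * completeKloosterman q h n
        = ∑ v ∈ Finset.range M, completeKloosterman q h n := by simp
      _ = ∑ v ∈ Finset.range M, ∑ u : (ZMod q)ˣ,
          ZMod.stdAddChar (h * (u : ZMod q) + n * (↑u⁻¹ : ZMod q)) *
            ZMod.stdAddChar (s * (h * (u : ZMod q) - n * (↑u⁻¹ : ZMod q)) * (v : ZMod q)) :=
          Finset.sum_congr rfl fun v _ => h1 v
      _ = _ := by
          rw [Finset.sum_comm, stationaryPoints, Finset.sum_filter, Finset.mul_sum]
          refine Finset.sum_congr rfl fun u _ => ?_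
          rw [← Finset.mul_sum, sum_range_addChar_mul _ M
            (by linear_combination (h * (u : ZMod q) - n * (↑u⁻¹ : ZMod q)) * hM)]
          split_ifs
          · rw [mul_comm]
          · simp
  exact mul_left_cancel₀ (Nat.cast_ne_zero.mpr hM0) h2
theorem norm_completeKloosterman_le_card_stationaryPoints {q : ℕ} [NeZero q] (h n s : ZMod q)
    (M : ℕ) (hM0 : M ≠ 0) (hM : s * M = 0) (hs : s ^ 2 = 0) :
    ‖completeKloosterman q h n‖ ≤ (stationaryPoints h n s).card := by
  rw [completeKloosterman_eq_sum_stationaryPoints h n s M hM0 hM hs]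
  refine (norm_sum_le _ _).trans ?_
  simp
theorem norm_quadratic_sum_le {p : ℕ} [Fact p.Prime] (hp2 : p ≠ 2) (t c : ZMod p) (hc : c ≠ 0) :
    ‖∑ v : ZMod p, ZMod.stdAddChar (t * v + c * v ^ 2)‖ ≤ Real.sqrt p := by
  have hp : p.Prime := Fact.out
  have h2 : (2 : ZMod p) ≠ 0 := by
    intro h
    have : ((2 : ℕ) : ZMod p) = 0 := by exact_mod_cast h
    rw [ZMod.natCast_eq_zero_iff] at this
    exact hp2 ((Nat.prime_dvd_prime_iff_eq hp Nat.prime_two).mp this)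
  set G := ∑ v : ZMod p, ZMod.stdAddChar (t * v + c * v ^ 2) with hG
  have h1 : G * (starRingEnd ℂ) G = p := by
    have e1 : G * (starRingEnd ℂ) G = ∑ d : ZMod p, ∑ w : ZMod p,
        ZMod.stdAddChar (t * d + c * d ^ 2) * ZMod.stdAddChar (w * (2 * c * d)) := by
      rw [Finset.sum_comm, map_sum, Finset.mul_sum]
      refine Finset.sum_congr rfl fun w _ => ?_
      rw [hG, Finset.sum_mul, ← Equiv.sum_comp (Equiv.addRight w)]
      refine Finset.sum_congr rfl fun d _ => ?_
      rw [← AddChar.map_neg_eq_conj, ← AddChar.map_add_eq_mul, ← AddChar.map_add_eq_mul,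
        Equiv.coe_addRight]
      congr 1
      ring
    have e2 : ∀ d : ZMod p, (∑ w : ZMod p,
        ZMod.stdAddChar (t * d + c * d ^ 2) * ZMod.stdAddChar (w * (2 * c * d))) =
        if d = 0 then (p : ℂ) else 0 := by
      intro d
      rw [← Finset.mul_sum, AddChar.sum_mulShift _ (ZMod.isPrimitive_stdAddChar p), ZMod.card]
      by_cases hd : d = 0
      · simp [hd]
      · rw [if_neg (mul_ne_zero (mul_ne_zero h2 hc) hd), if_neg hd, Nat.cast_zero, mul_zero]
    rw [e1, Finset.sum_congr rfl fun d _ => e2 d]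
    simp
  rw [Complex.mul_conj, Complex.normSq_eq_norm_sq] at h1
  have h3 : ‖G‖ ^ 2 = p := by exact_mod_cast h1
  exact Real.le_sqrt_of_sq_le h3.le
theorem prime_pow_dvd_two_mul_of_dvd_mul {p : ℕ} (hp : p.Prime) (m : ℕ) (x y : ℤ)
    (hy : ¬ (p : ℤ) ∣ y) (h : (p : ℤ) ^ m ∣ (x - y) * (x + y)) :
    (p : ℤ) ^ m ∣ 2 * (x - y) ∨ (p : ℤ) ^ m ∣ 2 * (x + y) := by
  have hpz : Prime (p : ℤ) := Nat.prime_iff_prime_int.mp hp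
  by_cases h2 : p = 2
  · subst h2
    rcases Nat.eq_zero_or_pos m with rfl | hm
    · simp
    have h4 : (2 : ℤ) ∣ (x - y) * (x + y) := (dvd_pow_self _ hm.ne').trans h
    have hA : (2 : ℤ) ∣ x - y := by
      rcases Int.prime_two.dvd_or_dvd h4 with h5 | h5 <;> omega
    obtain ⟨A, hA⟩ := hA
    have hB : x + y = 2 * (A + y) := by linarith
    rw [hA, hB] at h ⊢
    have hy' : ¬ (2 : ℤ) ∣ y := hy
    have hcop : ∀ B : ℤ, ¬ (2 : ℤ) ∣ B → IsCoprime (((2 : ℕ) : ℤ) ^ m) B := fun B hB =>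
      ((Int.prime_two.coprime_iff_not_dvd).mpr hB).pow_left
    by_cases hAe : (2 : ℤ) ∣ A
    · left
      refine (hcop (A + y) (by omega)).dvd_of_dvd_mul_right ?_
      rwa [show 2 * (2 * A) * (A + y) = 2 * A * (2 * (A + y)) by ring]
    · right
      refine (hcop A hAe).dvd_of_dvd_mul_right ?_
      rwa [show 2 * (2 * (A + y)) * A = 2 * A * (2 * (A + y)) by ring]
  · have hp2 : ¬ (p : ℤ) ∣ 2 := by
      intro h
      exact h2 ((Nat.prime_dvd_prime_iff_eq hp Nat.prime_two).mp (by exact_mod_cast h))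
    by_cases hA : (p : ℤ) ∣ x - y
    · have hB : ¬ (p : ℤ) ∣ x + y := by
        intro hB
        have h3 : (p : ℤ) ∣ 2 * y := by
          have := dvd_sub hB hA
          rwa [show x + y - (x - y) = 2 * y by ring] at this
        exact (hpz.dvd_or_dvd h3).elim hp2 hy
      left
      exact dvd_mul_of_dvd_right
        (((hpz.coprime_iff_not_dvd).mpr hB).pow_left.dvd_of_dvd_mul_right h) _
    · right
      exact dvd_mul_of_dvd_right
        (((hpz.coprime_iff_not_dvd).mpr hA).pow_left.dvd_of_dvd_mul_left h) _

theorem natCast_pow_eq_zero {p k e : ℕ} (he : k ≤ e) : (p : ZMod (p ^ k)) ^ e = 0 := by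
  rw [← Nat.cast_pow, ZMod.natCast_eq_zero_iff]
  exact pow_dvd_pow p he
theorem prime_pow_mul_intCast_eq_zero_iff {p : ℕ} (hp : p.Prime) (m r : ℕ) (z : ℤ) :
    (p : ZMod (p ^ (m + r))) ^ r * (z : ZMod (p ^ (m + r))) = 0 ↔ (p : ℤ) ^ m ∣ z := by
  have h1 : (p : ZMod (p ^ (m + r))) ^ r * (z : ZMod (p ^ (m + r))) =
      ((p ^ r * z : ℤ) : ZMod (p ^ (m + r))) := by push_cast; rfl
  have hp0 : (p : ℤ) ≠ 0 := by exact_mod_cast hp.ne_zero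
  rw [h1, ZMod.intCast_zmod_eq_zero_iff_dvd, Nat.cast_pow, pow_add, mul_comm]
  exact mul_dvd_mul_iff_left (pow_ne_zero r hp0)
theorem card_nsmul_sub_eq_zero_le {q : ℕ} [NeZero q] (N : ℕ) (hN : 0 < N) (y : ZMod q) :
    (Finset.univ.filter fun x : ZMod q => N • (x - y) = 0).card ≤ N := by
  refine le_trans (Finset.card_le_card_of_injOn (fun x => x - y) ?_ ?_)
    (IsAddCyclic.card_nsmul_eq_zero_le (α := ZMod q) hN)
  · intro x hx
    simpa using hx
  · intro x _ x' _ h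
    exact sub_left_injective h
theorem stationaryPoints_int {p : ℕ} [Fact p.Prime] {m r : ℕ} {h n : ℤ}
    {u : (ZMod (p ^ (m + r)))ˣ} (hu : u ∈ stationaryPoints (h : ZMod (p ^ (m + r))) n (p ^ r))
    {X : ℤ} (hX : (X : ZMod (p ^ (m + r))) = u) : (p : ℤ) ^ m ∣ h * X ^ 2 - n := by
  rw [← prime_pow_mul_intCast_eq_zero_iff Fact.out m r]
  have h1 := (Finset.mem_filter.mp hu).2
  have h2 : ((u⁻¹ : (ZMod (p ^ (m + r)))ˣ) : ZMod (p ^ (m + r))) * u = 1 := by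
    rw [← Units.val_mul, inv_mul_cancel, Units.val_one]
  push_cast
  rw [hX]
  linear_combination (u : ZMod (p ^ (m + r))) * h1 + (p : ZMod (p ^ (m + r))) ^ r * n * h2
theorem card_stationaryPoints_le {p : ℕ} [Fact p.Prime] {m r : ℕ} (hm : 1 ≤ m) (h n : ℤ)
    (hn : ¬ (p : ℤ) ∣ n) :
    (stationaryPoints (h : ZMod (p ^ (m + r))) n (p ^ r)).card ≤ 4 * p ^ r := by
  have hp : p.Prime := Fact.out
  have hpz : Prime (p : ℤ) := Nat.prime_iff_prime_int.mp hp
  have hpm : (p : ℤ) ∣ (p : ℤ) ^ m := dvd_pow_self _ (by omega)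
  rcases (stationaryPoints (h : ZMod (p ^ (m + r))) n (p ^ r)).eq_empty_or_nonempty
    with he | ⟨y, hy⟩
  · rw [he]; simp
  obtain ⟨Y, hY⟩ := ZMod.intCast_surjective (y : ZMod (p ^ (m + r)))
  have hYn := stationaryPoints_int hy hY
  have hphY : ¬ (p : ℤ) ∣ h * Y ^ 2 := fun hd => hn <| by
    have := dvd_sub hd (hpm.trans hYn)
    rwa [sub_sub_cancel] at this
  have hph : ¬ (p : ℤ) ∣ h := fun hd => hphY (hd.mul_right _)
  have hpY : ¬ (p : ℤ) ∣ Y := fun hd => hphY ((hd.pow two_ne_zero).mul_left _)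
  have hN : 0 < 2 * p ^ r := by have := hp.pos; positivity
  have hsub : ∀ x ∈ stationaryPoints (h : ZMod (p ^ (m + r))) n (p ^ r),
      (x : ZMod (p ^ (m + r))) ∈
        (Finset.univ.filter fun x : ZMod (p ^ (m + r)) => (2 * p ^ r) • (x - y) = 0) ∪
        (Finset.univ.filter fun x : ZMod (p ^ (m + r)) => (2 * p ^ r) • (x - (-y)) = 0) := by
    intro x hx
    obtain ⟨X, hX⟩ := ZMod.intCast_surjective (x : ZMod (p ^ (m + r)))
    have hXn := stationaryPoints_int hx hX
    have h1 : (p : ℤ) ^ m ∣ h * ((X - Y) * (X + Y)) := by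
      have := dvd_sub hXn hYn
      rwa [show h * X ^ 2 - n - (h * Y ^ 2 - n) = h * ((X - Y) * (X + Y)) by ring] at this
    have h2 := ((hpz.coprime_iff_not_dvd).mpr hph).pow_left.dvd_of_dvd_mul_left h1
    rw [Finset.mem_union, Finset.mem_filter, Finset.mem_filter, ← hX, ← hY]
    refine (prime_pow_dvd_two_mul_of_dvd_mul hp m X Y hpY h2).imp (fun h3 => ?_) (fun h3 => ?_)
    all_goals
      refine ⟨Finset.mem_univ _, ?_⟩
      rw [← prime_pow_mul_intCast_eq_zero_iff hp m r] at h3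
      push_cast at h3
      rw [nsmul_eq_mul, ← h3]
      push_cast
      ring
  refine (Finset.card_le_card_of_injOn _ hsub fun _ _ _ _ h => Units.ext h).trans ?_
  refine (Finset.card_union_le _ _).trans ?_
  have h1 := card_nsmul_sub_eq_zero_le (2 * p ^ r) hN (y : ZMod (p ^ (m + r)))
  have h2 := card_nsmul_sub_eq_zero_le (2 * p ^ r) hN (-y : ZMod (p ^ (m + r)))
  omega
theorem norm_completeKloosterman_even_le {p : ℕ} [Fact p.Prime] {m r : ℕ} (hm : 1 ≤ m) (hmr : m ≤ r)
    (h n : ℤ) (hn : ¬ (p : ℤ) ∣ n) :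
    ‖completeKloosterman (p ^ (m + r)) h n‖ ≤ 4 * (p : ℝ) ^ r := by
  have hp : p.Prime := Fact.out
  have hq : ∀ e, m + r ≤ e → (p : ZMod (p ^ (m + r))) ^ e = 0 := fun e he =>
    natCast_pow_eq_zero he
  refine (norm_completeKloosterman_le_card_stationaryPoints _ _ ((p : ZMod (p ^ (m + r))) ^ r)
    (p ^ m) (pow_ne_zero _ hp.ne_zero) ?_ ?_).trans ?_
  · rw [Nat.cast_pow, ← pow_add]
    exact hq _ (by omega)
  · rw [← pow_mul]
    exact hq _ (by omega)
  · exact_mod_cast card_stationaryPoints_le hm h n hn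
theorem completeKloosterman_eq_zero {p : ℕ} [Fact p.Prime] {r : ℕ} (hr : 1 ≤ r) (h n : ℤ)
    (hn : (p : ℤ) ∣ n) (hh : ¬ (p : ℤ) ∣ h) :
    completeKloosterman (p ^ (1 + r)) h n = 0 := by
  have hp : p.Prime := Fact.out
  have hpz : Prime (p : ℤ) := Nat.prime_iff_prime_int.mp hp
  have hq : ∀ e, 1 + r ≤ e → (p : ZMod (p ^ (1 + r))) ^ e = 0 := fun e he =>
    natCast_pow_eq_zero he
  rw [completeKloosterman_eq_sum_stationaryPoints _ _ ((p : ZMod (p ^ (1 + r))) ^ r) p hp.ne_zero]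
  · refine Finset.sum_eq_zero fun u hu => ?_
    exfalso
    obtain ⟨X, hX⟩ := ZMod.intCast_surjective (u : ZMod (p ^ (1 + r)))
    have h1 := stationaryPoints_int hu hX
    rw [pow_one] at h1
    have h2 : (p : ℤ) ∣ h * X ^ 2 := by
      have := dvd_add h1 hn
      rwa [sub_add_cancel] at this
    have h3 := hpz.dvd_of_dvd_pow ((hpz.dvd_or_dvd h2).resolve_left hh)
    have h4 : IsUnit (X : ZMod (p ^ (1 + r))) := hX ▸ u.isUnit
    rw [ZMod.coe_int_isUnit_iff_isCoprime] at h4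
    have h5 : IsUnit (p : ℤ) := by
      refine h4.isUnit_of_dvd' ?_ h3
      push_cast
      exact dvd_pow_self _ (by omega)
    exact hpz.not_isUnit h5
  · rw [← pow_succ]
    exact hq _ (by omega)
  · rw [← pow_mul]
    exact hq _ (by omega)

theorem stdAddChar_intCast_mul {N a b : ℕ} [NeZero N] [NeZero b] (hN : N = a * b) (y : ℤ) :
    ZMod.stdAddChar ((a * y : ℤ) : ZMod N) = ZMod.stdAddChar (y : ZMod b) := by
  rw [ZMod.stdAddChar_coe, ZMod.stdAddChar_coe]
  congr 1
  have hN0 : (N : ℂ) ≠ 0 := Nat.cast_ne_zero.mpr (NeZero.ne N)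
  have hb : (b : ℂ) ≠ 0 := Nat.cast_ne_zero.mpr (NeZero.ne b)
  have hNC : (N : ℂ) = a * b := by exact_mod_cast hN
  rw [div_eq_div_iff hN0 hb, hNC]
  push_cast
  ring
theorem sum_range_natCast_zmod {M : Type*} [AddCommMonoid M] {q : ℕ} [NeZero q] (f : ZMod q → M) :
    ∑ v ∈ Finset.range q, f (v : ZMod q) = ∑ v : ZMod q, f v :=
  Finset.sum_nbij' (fun v => (v : ZMod q)) ZMod.val (fun _ _ => Finset.mem_univ _)
    (fun v _ => Finset.mem_range.mpr (ZMod.val_lt v))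
    (fun _ hv => ZMod.val_natCast_of_lt (Finset.mem_range.mp hv))
    (fun v _ => ZMod.natCast_zmod_val v) (fun _ _ => rfl)
theorem mul_oneAddUnit_mem_stationaryPoints {q : ℕ} [NeZero q] {h n s z : ZMod q} (hz : z ^ 3 = 0)
    (hsz : s * z = 0) (u : (ZMod q)ˣ) :
    u * oneAddUnit z hz ∈ stationaryPoints h n s ↔ u ∈ stationaryPoints h n s := by
  simp only [stationaryPoints, Finset.mem_filter, Finset.mem_univ, true_and]
  have h1 : ((oneAddUnit z hz : (ZMod q)ˣ) : ZMod q) = 1 + z := rfl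
  have h2 : (((oneAddUnit z hz)⁻¹ : (ZMod q)ˣ) : ZMod q) = 1 - z + z ^ 2 := rfl
  rw [mul_inv, Units.val_mul, Units.val_mul, h1, h2]
  have : s * (h * (u * (1 + z)) - n * ((↑u⁻¹ : ZMod q) * (1 - z + z ^ 2))) =
      s * (h * u - n * (↑u⁻¹ : ZMod q)) := by
    linear_combination (h * u + n * (↑u⁻¹ : ZMod q) * (1 - z)) * hsz
  rw [this]
theorem norm_completeKloosterman_odd_le {p : ℕ} [Fact p.Prime] (hp2 : p ≠ 2) {m : ℕ} (hm : 1 ≤ m)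
    (h n : ℤ) (hn : ¬ (p : ℤ) ∣ n) :
    ‖completeKloosterman (p ^ (m + (m + 1))) h n‖ ≤ 4 * (p : ℝ) ^ m * Real.sqrt p := by
  have hp : p.Prime := Fact.out
  have hpz : Prime (p : ℤ) := Nat.prime_iff_prime_int.mp hp
  set q := p ^ (m + (m + 1)) with hq
  have hq0 : ∀ e, m + (m + 1) ≤ e → (p : ZMod q) ^ e = 0 := fun e he => natCast_pow_eq_zero he
  set S := stationaryPoints (h : ZMod q) n ((p : ZMod q) ^ (m + 1)) with hS
  have hK : completeKloosterman q h n =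
      ∑ u ∈ S, ZMod.stdAddChar ((h : ZMod q) * (u : ZMod q) + (n : ZMod q) * (↑u⁻¹ : ZMod q)) := by
    refine completeKloosterman_eq_sum_stationaryPoints _ _ _ (p ^ m)
      (pow_ne_zero _ hp.ne_zero) ?_ ?_
    · rw [Nat.cast_pow, ← pow_add]
      exact hq0 _ (by omega)
    · rw [← pow_mul]
      exact hq0 _ (by omega)
  have hz : ∀ v : ℕ, ((p : ZMod q) ^ m * (v : ZMod q)) ^ 3 = 0 := fun v => by
    rw [mul_pow, ← pow_mul, hq0 _ (by omega), zero_mul]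
  have hsz : ∀ v : ℕ, (p : ZMod q) ^ (m + 1) * ((p : ZMod q) ^ m * (v : ZMod q)) = 0 := fun v => by
    rw [← mul_assoc, ← pow_add, hq0 _ (by omega), zero_mul]
  have hshift : ∀ v : ℕ, completeKloosterman q h n =
      ∑ u ∈ S, ZMod.stdAddChar ((h : ZMod q) * (u : ZMod q) + (n : ZMod q) * (↑u⁻¹ : ZMod q)) *
        ZMod.stdAddChar (((h : ZMod q) * (u : ZMod q) - (n : ZMod q) * (↑u⁻¹ : ZMod q)) *
            ((p : ZMod q) ^ m * (v : ZMod q)) +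
          (n : ZMod q) * (↑u⁻¹ : ZMod q) * ((p : ZMod q) ^ m * (v : ZMod q)) ^ 2) := by
    intro v
    rw [hK]
    symm
    refine Finset.sum_bij (fun u _ => u * oneAddUnit _ (hz v))
      (fun u hu => (mul_oneAddUnit_mem_stationaryPoints (hz v) (hsz v) u).mpr hu)
      (fun u _ u' _ h => mul_right_cancel h) (fun u hu => ?_)
      (fun u _ => (addChar_mul_oneAddUnit _ _ _ _ (hz v) u).symm)
    refine ⟨u * (oneAddUnit _ (hz v))⁻¹, ?_, inv_mul_cancel_right _ _⟩
    rw [← mul_oneAddUnit_mem_stationaryPoints (hz v) (hsz v), inv_mul_cancel_right]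
    exact hu
  have hinner : ∀ u ∈ S, ‖∑ v ∈ Finset.range p,
      ZMod.stdAddChar (((h : ZMod q) * (u : ZMod q) - (n : ZMod q) * (↑u⁻¹ : ZMod q)) *
        ((p : ZMod q) ^ m * (v : ZMod q)) +
          (n : ZMod q) * (↑u⁻¹ : ZMod q) * ((p : ZMod q) ^ m * (v : ZMod q)) ^ 2)‖ ≤
        Real.sqrt p := by
    intro u hu
    obtain ⟨Z, hZ⟩ := ZMod.intCast_surjective
      ((h : ZMod q) * (u : ZMod q) - (n : ZMod q) * (↑u⁻¹ : ZMod q))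
    obtain ⟨V, hV⟩ := ZMod.intCast_surjective (↑u⁻¹ : ZMod q)
    have h1 := (Finset.mem_filter.mp hu).2
    rw [← hZ, prime_pow_mul_intCast_eq_zero_iff hp] at h1
    obtain ⟨T, rfl⟩ := h1
    have hpV : ¬ (p : ℤ) ∣ V := by
      intro hd
      have h4 : IsUnit (V : ZMod q) := hV ▸ (u⁻¹).isUnit
      rw [ZMod.coe_int_isUnit_iff_isCoprime] at h4
      refine hpz.not_isUnit (h4.isUnit_of_dvd' ?_ hd)
      rw [hq, Nat.cast_pow]
      exact dvd_pow_self _ (by omega)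
    have hnV : ((n * V : ℤ) : ZMod p) ≠ 0 := by
      rw [Ne, ZMod.intCast_zmod_eq_zero_iff_dvd]
      exact fun hd => (hpz.dvd_or_dvd hd).elim hn hpV
    have h2 : ∀ v : ℕ,
        ZMod.stdAddChar (((h : ZMod q) * (u : ZMod q) - (n : ZMod q) * (↑u⁻¹ : ZMod q)) *
          ((p : ZMod q) ^ m * (v : ZMod q)) +
            (n : ZMod q) * (↑u⁻¹ : ZMod q) * ((p : ZMod q) ^ m * (v : ZMod q)) ^ 2) =
        ZMod.stdAddChar ((T : ZMod p) * (v : ZMod p) + ((n * V : ℤ) : ZMod p) *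
          (v : ZMod p) ^ 2) := by
      intro v
      have h3 := stdAddChar_intCast_mul (N := q) (a := p ^ (2 * m)) (b := p)
        (by rw [hq, ← pow_succ]; congr 1; ring) (T * v + n * V * v ^ 2)
      push_cast at h3 ⊢
      rw [← h3, ← hZ, ← hV]
      congr 1
      push_cast
      ring
    rw [Finset.sum_congr rfl fun v _ => h2 v,
      sum_range_natCast_zmod fun v : ZMod p => ZMod.stdAddChar ((T : ZMod p) * v +
        ((n * V : ℤ) : ZMod p) * v ^ 2)]
    exact norm_quadratic_sum_le hp2 _ _ hnV
  have hsum : (p : ℂ) * completeKloosterman q h n =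
      ∑ u ∈ S, ZMod.stdAddChar ((h : ZMod q) * (u : ZMod q) + (n : ZMod q) * (↑u⁻¹ : ZMod q)) *
        ∑ v ∈ Finset.range p,
          ZMod.stdAddChar (((h : ZMod q) * (u : ZMod q) - (n : ZMod q) * (↑u⁻¹ : ZMod q)) *
            ((p : ZMod q) ^ m * (v : ZMod q)) +
          (n : ZMod q) * (↑u⁻¹ : ZMod q) * ((p : ZMod q) ^ m * (v : ZMod q)) ^ 2) := by
    calc (p : ℂ) * completeKloosterman q h n
        = ∑ v ∈ Finset.range p, completeKloosterman q h n := by simp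
      _ = _ := by
        rw [Finset.sum_congr rfl fun v _ => hshift v, Finset.sum_comm]
        simp only [Finset.mul_sum]
  have hp0 : (0 : ℝ) < p := by exact_mod_cast hp.pos
  have hfin : (p : ℝ) * ‖completeKloosterman q h n‖ ≤ p * (4 * (p : ℝ) ^ m * Real.sqrt p) := by
    calc (p : ℝ) * ‖completeKloosterman q h n‖ = ‖(p : ℂ) * completeKloosterman q h n‖ := by simp
      _ ≤ ∑ u ∈ S, Real.sqrt p := by
        rw [hsum]
        refine (norm_sum_le _ _).trans (Finset.sum_le_sum fun u hu => ?_)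
        rw [norm_mul, AddChar.norm_apply, one_mul]
        exact hinner u hu
      _ = S.card * Real.sqrt p := by rw [Finset.sum_const, nsmul_eq_mul]
      _ ≤ ((4 * p ^ (m + 1) : ℕ) : ℝ) * Real.sqrt p := by
        gcongr
        exact card_stationaryPoints_le hm h n hn
      _ = _ := by push_cast; ring
  exact le_of_mul_le_mul_left hfin hp0
theorem sum_units_eq {F : Type*} [Field F] [Fintype F] [Fintype Fˣ] [DecidableEq F] (f : F → ℂ) :
    ∑ u : Fˣ, f u = ∑ x : F, if x = 0 then 0 else f x := by
  have h1 : ∑ x : F, (if x = 0 then 0 else f x) =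
      ∑ x ∈ Finset.univ.filter (fun x : F => x ≠ 0), f x := by
    rw [Finset.sum_filter]
    exact Finset.sum_congr rfl fun x _ => by rw [ite_not]
  rw [h1]
  exact Finset.sum_bij (fun u _ => (u : F)) (fun u _ => by simp)
    (fun u _ v _ h => Units.ext h)
    (fun x hx => ⟨Units.mk0 x (Finset.mem_filter.mp hx).2, Finset.mem_univ _, rfl⟩)
    (fun _ _ => rfl)
theorem norm_completeKloosterman_prime_le {p : ℕ} [Fact p.Prime] (hp2 : p ≠ 2) (h n : ZMod p)
    (hn : n ≠ 0) : ‖completeKloosterman p h n‖ ≤ 2 * Real.sqrt p := by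
  have hp : p.Prime := Fact.out
  have hp1 : (1 : ℝ) ≤ Real.sqrt p := Real.one_le_sqrt.mpr (by exact_mod_cast hp.one_lt.le)
  have hK : completeKloosterman p h n = ∑ x : ZMod p, if x = 0 then 0 else
      ZMod.stdAddChar (h * x + n * x⁻¹) := by
    refine Eq.trans (Finset.sum_congr rfl fun u _ => ?_)
      (sum_units_eq fun x : ZMod p => ZMod.stdAddChar (h * x + n * x⁻¹))
    rw [Units.val_inv_eq_inv_val]
  by_cases hh : h = 0
  · have h1 : completeKloosterman p h n = -1 := by
      rw [completeKloosterman, ← Equiv.sum_comp (Equiv.inv _)]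
      simp only [Equiv.inv_apply, inv_inv, hh, zero_mul, zero_add]
      refine (sum_units_eq fun x : ZMod p => ZMod.stdAddChar (n * x)).trans ?_
      have h2 := AddChar.sum_mulShift n (ZMod.isPrimitive_stdAddChar p)
      rw [if_neg hn, ← Finset.add_sum_erase _ _ (Finset.mem_univ (0 : ZMod p))] at h2
      rw [← Finset.add_sum_erase _ _ (Finset.mem_univ (0 : ZMod p)), if_pos rfl, zero_add]
      rw [zero_mul, AddChar.map_zero_eq_one, Nat.cast_zero] at h2
      rw [eq_neg_iff_add_eq_zero, add_comm, ← h2]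
      congr 1
      refine Finset.sum_congr rfl fun x hx => ?_
      rw [if_neg (Finset.ne_of_mem_erase hx), mul_comm]
    rw [h1, norm_neg, norm_one]
    linarith
  · have h1 : completeKloosterman p h n = extensionSum (ZMod p) ZMod.stdAddChar h n := by
      rw [hK, extensionSum]
      simp only [Algebra.trace_self_apply, Algebra.algebraMap_self, RingHom.id_apply]
    have hψ : (ZMod.stdAddChar (N := p)) ≠ 1 := fun h => by
      have h2 := DFunLike.congr_fun h (1 : ZMod p)
      rw [AddChar.one_apply, ← AddChar.map_zero_eq_one (ZMod.stdAddChar (N := p))] at h2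
      exact one_ne_zero (ZMod.injective_stdAddChar h2)
    rw [h1]
    exact norm_extensionSum_le hp2 _ hψ h n hh hn

end PrimePowers

section PrimePowerBound

theorem sum_comp_surjective_monoidHom {G H : Type*} [Group G] [Group H] [Fintype G] [Fintype H]
    (f : G →* H) (hf : Function.Surjective f) (c : ℕ)
    (hc : Fintype.card G = c * Fintype.card H) (F : H → ℂ) :
    ∑ g, F (f g) = c * ∑ x, F x := by
  have hfib : ∀ x : H, (Finset.univ.filter fun g => f g = x).card = c := by
    intro x
    have h1 : Fintype.card G =
        ∑ y : H, (Finset.univ.filter fun g => f g = y).card :=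
      Finset.card_eq_sum_card_fiberwise (f := f) (s := Finset.univ) (t := Finset.univ)
        (by simp [Set.MapsTo])
    rw [Finset.sum_congr rfl fun y _ =>
      MonoidHom.card_fiber_eq_of_mem_range f (hf y) (hf x), Finset.sum_const, Finset.card_univ,
      smul_eq_mul, hc, mul_comm] at h1
    exact (Nat.eq_of_mul_eq_mul_left Fintype.card_pos h1).symm
  rw [Finset.sum_comp F f, Finset.image_univ_of_surjective hf, Finset.mul_sum]
  refine Finset.sum_congr rfl fun x _ => ?_
  rw [hfib x, nsmul_eq_mul]
theorem completeKloosterman_mul_prime {p : ℕ} [Fact p.Prime] (k : ℕ) (h n : ℤ) :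
    completeKloosterman (p ^ (k + 2)) ((p * h : ℤ) : ZMod (p ^ (k + 2)))
        ((p * n : ℤ) : ZMod (p ^ (k + 2))) =
      p * completeKloosterman (p ^ (k + 1)) h n := by
  have hp : p.Prime := Fact.out
  have hd : p ^ (k + 1) ∣ p ^ (k + 2) := pow_dvd_pow p (by omega)
  rw [completeKloosterman, completeKloosterman,
    ← sum_comp_surjective_monoidHom (ZMod.unitsMap hd) (ZMod.unitsMap_surjective hd) p]
  · refine Finset.sum_congr rfl fun u _ => ?_
    rw [← map_inv]
    obtain ⟨U, hU⟩ := ZMod.intCast_surjective (u : ZMod (p ^ (k + 2)))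
    obtain ⟨V, hV⟩ := ZMod.intCast_surjective (↑u⁻¹ : ZMod (p ^ (k + 2)))
    have h1 : ∀ v : (ZMod (p ^ (k + 2)))ˣ, ((ZMod.unitsMap hd v : (ZMod (p ^ (k + 1)))ˣ) :
        ZMod (p ^ (k + 1))) = ZMod.castHom hd (ZMod (p ^ (k + 1))) v := fun v => by
      rw [ZMod.unitsMap_val, ZMod.castHom_apply]
    rw [h1, h1, ← hU, ← hV, map_intCast, map_intCast]
    have h2 := stdAddChar_intCast_mul (N := p ^ (k + 2)) (a := p) (b := p ^ (k + 1)) (by ring)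
      (h * U + n * V)
    push_cast at h2 ⊢
    rw [← h2]
    congr 1
    ring
  · rw [ZMod.card_units_eq_totient, ZMod.card_units_eq_totient, Nat.totient_prime_pow_succ hp,
      Nat.totient_prime_pow_succ hp]
    ring
theorem norm_completeKloosterman_le (q : ℕ) [NeZero q] (h n : ZMod q) :
    ‖completeKloosterman q h n‖ ≤ q.totient := by
  refine (norm_sum_le _ _).trans ?_
  rw [Finset.sum_congr rfl fun u _ => AddChar.norm_apply _ _, Finset.sum_const, nsmul_eq_mul,
    mul_one, Finset.card_univ, ZMod.card_units_eq_totient]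
theorem norm_completeKloosterman_prime_pow_of_not_dvd {p : ℕ} [Fact p.Prime] {k : ℕ} (hk : 1 ≤ k)
    (h n : ℤ) (hn : ¬ (p : ℤ) ∣ n) :
    ‖completeKloosterman (p ^ k) h n‖ ≤ 8 * Real.sqrt ((p ^ k : ℕ) : ℝ) := by
  have hp : p.Prime := Fact.out
  have hp0 : (0 : ℝ) ≤ p := Nat.cast_nonneg p
  have hs : ∀ m : ℕ, Real.sqrt (((p : ℝ) ^ (m + m))) = p ^ m := fun m => by
    rw [← two_mul, mul_comm, pow_mul, Real.sqrt_sq (by positivity)]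
  have hs' : ∀ m : ℕ, Real.sqrt (((p : ℝ) ^ (m + (m + 1)))) = p ^ m * Real.sqrt p := fun m => by
    rw [← add_assoc, pow_succ, Real.sqrt_mul (by positivity), hs]
  rcases Nat.even_or_odd' k with ⟨m, rfl | rfl⟩
  · rw [two_mul, Nat.cast_pow, hs]
    refine (norm_completeKloosterman_even_le (by omega) le_rfl h n hn).trans ?_
    have : (0 : ℝ) ≤ (p : ℝ) ^ m := by positivity
    linarith
  · rw [show 2 * m + 1 = m + (m + 1) by ring, Nat.cast_pow, hs']
    have h0 : (0 : ℝ) ≤ (p : ℝ) ^ m * Real.sqrt p := by positivity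
    rcases Nat.eq_zero_or_pos m with rfl | hm
    · by_cases hp2 : p = 2
      · subst hp2
        refine (norm_completeKloosterman_le _ _ _).trans ?_
        have : (1 : ℝ) ≤ Real.sqrt 2 := Real.one_le_sqrt.mpr (by norm_num)
        norm_num
        linarith
      · have hn' : (n : ZMod p) ≠ 0 := by rwa [Ne, ZMod.intCast_zmod_eq_zero_iff_dvd]
        have h1 := norm_completeKloosterman_prime_le hp2 (h : ZMod p) n hn'
        have h2 : ∀ N : ℕ, N = p → ∀ _ : NeZero N,
            ‖completeKloosterman N h n‖ ≤ 2 * Real.sqrt p := by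
          rintro N rfl _
          convert h1
        refine (h2 (p ^ (0 + (0 + 1))) (by simp) _).trans ?_
        simp only [pow_zero, one_mul] at h0 ⊢
        linarith
    · by_cases hp2 : p = 2
      · refine (norm_completeKloosterman_even_le hm (by omega) h n hn).trans ?_
        have h3 : Real.sqrt p * Real.sqrt p = p := Real.mul_self_sqrt hp0
        have h4 : Real.sqrt p ≤ 2 := by
          rw [hp2, Real.sqrt_le_left (by norm_num)]
          norm_num
        have h5 : (p : ℝ) ≤ 2 * Real.sqrt p := by
          nlinarith [Real.sqrt_nonneg p]
        have h6 : (0 : ℝ) ≤ (p : ℝ) ^ m := by positivity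
        rw [pow_succ]
        nlinarith
      · refine (norm_completeKloosterman_odd_le hp2 hm h n hn).trans ?_
        linarith
theorem norm_completeKloosterman_prime_pow_le {p : ℕ} [Fact p.Prime] (k : ℕ) (h n : ℤ) :
    ‖completeKloosterman (p ^ k) h n‖ ≤
      8 * Real.sqrt (Int.gcd n (p ^ k : ℕ)) * Real.sqrt ((p ^ k : ℕ) : ℝ) := by
  have hp : p.Prime := Fact.out
  have hgcd : ∀ j (z : ℤ), (1 : ℝ) ≤ Real.sqrt (Int.gcd z (p ^ j : ℕ)) := fun j z => by
    rw [Real.one_le_sqrt]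
    have : 0 < Int.gcd z (p ^ j : ℕ) :=
      Int.gcd_pos_of_ne_zero_right _ (by exact_mod_cast pow_ne_zero j hp.ne_zero)
    exact_mod_cast this
  have hgood : ∀ j, 1 ≤ j → ∀ h n : ℤ, ¬ (p : ℤ) ∣ n → ‖completeKloosterman (p ^ j) h n‖ ≤
      8 * Real.sqrt (Int.gcd n (p ^ j : ℕ)) * Real.sqrt ((p ^ j : ℕ) : ℝ) := fun j hj h n hn => by
    refine (norm_completeKloosterman_prime_pow_of_not_dvd hj h n hn).trans ?_
    nlinarith [hgcd j n, Real.sqrt_nonneg ((p ^ j : ℕ) : ℝ)]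
  rcases k with _ | k
  · refine (norm_completeKloosterman_le _ _ _).trans ?_
    simp
  induction k generalizing h n with
  | zero =>
    by_cases hn : (p : ℤ) ∣ n
    · refine (norm_completeKloosterman_le _ _ _).trans ?_
      have h1 : Int.gcd n (p ^ (0 + 1) : ℕ) = p := by
        rw [zero_add, pow_one]
        exact Nat.gcd_eq_right (Int.natCast_dvd.mp hn)
      rw [h1, zero_add, pow_one, mul_assoc, Real.mul_self_sqrt (Nat.cast_nonneg p)]
      have h2 : (p.totient : ℝ) ≤ p := by exact_mod_cast Nat.totient_le p
      linarith [(Nat.cast_nonneg p : (0 : ℝ) ≤ p)]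
    · exact hgood _ (by omega) h n hn
  | succ k ih =>
    by_cases hn : (p : ℤ) ∣ n
    · by_cases hh : (p : ℤ) ∣ h
      · obtain ⟨n, rfl⟩ := hn
        obtain ⟨h, rfl⟩ := hh
        rw [completeKloosterman_mul_prime, norm_mul, Complex.norm_natCast]
        have h1 : Int.gcd (p * n) (p ^ (k + 1 + 1) : ℕ) = p * Int.gcd n (p ^ (k + 1) : ℕ) := by
          rw [pow_succ' p (k + 1), Nat.cast_mul, Int.gcd_mul_left, Int.natAbs_natCast]
        rw [h1, pow_succ' p (k + 1), Nat.cast_mul, Nat.cast_mul, Real.sqrt_mul (Nat.cast_nonneg p),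
          Real.sqrt_mul (Nat.cast_nonneg p)]
        calc (p : ℝ) * ‖completeKloosterman (p ^ (k + 1)) h n‖ ≤ _ :=
              mul_le_mul_of_nonneg_left (ih h n) (Nat.cast_nonneg p)
          _ = (Real.sqrt p * Real.sqrt p) * (8 * Real.sqrt (Int.gcd n (p ^ (k + 1) : ℕ)) *
              Real.sqrt ((p ^ (k + 1) : ℕ) : ℝ)) := by rw [Real.mul_self_sqrt (Nat.cast_nonneg p)]
          _ = _ := by ring
      · have h1 := completeKloosterman_eq_zero (r := k + 1) (by omega) h n hn hh
        rw [show 1 + (k + 1) = k + 1 + 1 by ring] at h1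
        rw [h1, norm_zero]
        positivity
    · exact hgood _ (by omega) h n hn

end PrimePowerBound

section CompositeModulus

theorem stdAddChar_intCast_mul_mul {N a b : ℕ} [NeZero N] [NeZero a] [NeZero b] (hN : N = a * b)
    {r s : ℤ} (hrs : a * r + b * s = 1) (y : ℤ) :
    ZMod.stdAddChar (y : ZMod N) =
      ZMod.stdAddChar ((s * y : ℤ) : ZMod a) * ZMod.stdAddChar ((r * y : ℤ) : ZMod b) := by
  rw [← stdAddChar_intCast_mul (N := N) (a := b) (b := a) (by rw [hN, mul_comm]),
    ← stdAddChar_intCast_mul (N := N) (a := a) (b := b) hN, ← AddChar.map_add_eq_mul,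
    ← Int.cast_add]
  congr 2
  linear_combination (-y) * hrs
/-- Twisted multiplicativity of complete Kloosterman sums. -/
theorem completeKloosterman_mul {a b : ℕ} [NeZero a] [NeZero b] [NeZero (a * b)]
    (hab : a.Coprime b) {r s : ℤ} (hrs : a * r + b * s = 1) (h n : ℤ) :
    completeKloosterman (a * b) h n =
      completeKloosterman a ((s * h : ℤ) : ZMod a) ((s * n : ℤ) : ZMod a) *
        completeKloosterman b ((r * h : ℤ) : ZMod b) ((r * n : ℤ) : ZMod b) := by
  let e : (ZMod (a * b))ˣ ≃* (ZMod a)ˣ × (ZMod b)ˣ :=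
    (Units.mapEquiv (ZMod.chineseRemainder hab).toMulEquiv).trans MulEquiv.prodUnits
  have he : ∀ (u : (ZMod (a * b))ˣ) (U : ℤ), (U : ZMod (a * b)) = u →
      ((e u).1 : ZMod a) = U ∧ ((e u).2 : ZMod b) = U := by
    intro u U hU
    have h1 : ((e u).1 : ZMod a) = (ZMod.chineseRemainder hab u).1 := rfl
    have h2 : ((e u).2 : ZMod b) = (ZMod.chineseRemainder hab u).2 := rfl
    rw [h1, h2, ← hU, map_intCast]
    exact ⟨rfl, rfl⟩
  rw [completeKloosterman, completeKloosterman, completeKloosterman, Finset.sum_mul_sum,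
    ← Fintype.sum_prod_type', ← Equiv.sum_comp e.toEquiv]
  refine Finset.sum_congr rfl fun u _ => ?_
  obtain ⟨U, hU⟩ := ZMod.intCast_surjective (u : ZMod (a * b))
  obtain ⟨V, hV⟩ := ZMod.intCast_surjective (↑u⁻¹ : ZMod (a * b))
  have h1 := he u U hU
  have h2 := he u⁻¹ V hV
  rw [map_inv, Prod.fst_inv, Prod.snd_inv] at h2
  have h3 := stdAddChar_intCast_mul_mul (N := a * b) rfl hrs (h * U + n * V)
  simp only [MulEquiv.toEquiv_eq_coe, EquivLike.coe_coe]
  rw [h1.1, h1.2, h2.1, h2.2, ← hU, ← hV]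
  push_cast at h3 ⊢
  rw [h3]
  congr 2 <;> ring
theorem int_gcd_mul_left_of_isCoprime {s z : ℤ} {a : ℕ} (hs : IsCoprime s a) :
    Int.gcd (s * z) a = Int.gcd z a := by
  rw [Int.gcd, Int.gcd, Int.natAbs_mul]
  exact Nat.Coprime.gcd_mul_left_cancel _ (Int.isCoprime_iff_gcd_eq_one.mp hs)
/-- **Weil's bound** for complete Kloosterman sums to an arbitrary modulus. -/
theorem norm_completeKloosterman_le_pow_card_primeFactors (q : ℕ) [NeZero q] (h n : ℤ) :
    ‖completeKloosterman q h n‖ ≤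
      8 ^ q.primeFactors.card * Real.sqrt (Int.gcd n q) * Real.sqrt q := by
  have key : ∀ q : ℕ, ∀ _ : NeZero q, ∀ h n : ℤ, ‖completeKloosterman q h n‖ ≤
      8 ^ q.primeFactors.card * Real.sqrt (Int.gcd n q) * Real.sqrt q := by
    intro q
    induction q using Nat.recOnPosPrimePosCoprime with
    | zero => exact fun h => absurd rfl h.out
    | one =>
      intro _ h n
      refine (norm_completeKloosterman_le _ _ _).trans ?_
      simp
    | prime_pow p k hp hk =>
      intro _ h n
      have : Fact p.Prime := ⟨hp⟩
      rw [Nat.primeFactors_prime_pow hk.ne' hp, Finset.card_singleton, pow_one]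
      exact norm_completeKloosterman_prime_pow_le k h n
    | coprime a b ha hb hab iha ihb =>
      intro _ h n
      have : NeZero a := ⟨by omega⟩
      have : NeZero b := ⟨by omega⟩
      obtain ⟨r, s, hrs⟩ := Nat.isCoprime_iff_coprime.mpr hab
      have hrs' : (a : ℤ) * r + b * s = 1 := by linear_combination hrs
      have hs : IsCoprime s (a : ℤ) := ⟨b, r, by linear_combination hrs⟩
      have hr : IsCoprime r (b : ℤ) := ⟨a, s, by linear_combination hrs⟩
      have h1 := iha inferInstance (s * h) (s * n)
      have h2 := ihb inferInstance (r * h) (r * n)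
      rw [int_gcd_mul_left_of_isCoprime hs] at h1
      rw [int_gcd_mul_left_of_isCoprime hr] at h2
      have hg : Int.gcd n (a * b : ℕ) = Int.gcd n a * Int.gcd n b := by
        simp only [Int.gcd, Int.natAbs_natCast]
        exact hab.gcd_mul _
      rw [completeKloosterman_mul hab hrs', norm_mul, hg, hab.primeFactors_mul,
        Finset.card_union_of_disjoint hab.disjoint_primeFactors, pow_add, Nat.cast_mul,
        Nat.cast_mul, Real.sqrt_mul (Nat.cast_nonneg _), Real.sqrt_mul (Nat.cast_nonneg _)]
      refine (mul_le_mul h1 h2 (norm_nonneg _) (by positivity)).trans_eq ?_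
      ring
  exact key q inferInstance h n
theorem exists_pow_card_primeFactors_le (A ε : ℝ) (hA : 1 ≤ A) (hε : 0 < ε) :
    ∃ C : ℝ, 0 < C ∧ ∀ q : ℕ, q ≠ 0 → A ^ q.primeFactors.card ≤ C * (q : ℝ) ^ ε := by
  obtain ⟨N, hN⟩ := exists_nat_ge (A ^ ε⁻¹)
  have hA0 : 0 < A := one_pos.trans_le hA
  refine ⟨A ^ N, by positivity, fun q hq => ?_⟩
  have hpt : ∀ p ∈ q.primeFactors, A ≤ (if p < N then A else 1) * (p : ℝ) ^ ε := by
    intro p hp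
    have hp1 : (1 : ℝ) ≤ p := by exact_mod_cast (Nat.prime_of_mem_primeFactors hp).one_lt.le
    split_ifs with hpN
    · exact le_mul_of_one_le_right hA0.le (Real.one_le_rpow hp1 hε.le)
    · have h1 : (N : ℝ) ≤ p := by exact_mod_cast not_lt.mp hpN
      rw [one_mul, ← Real.rpow_inv_le_iff_of_pos hA0.le (by positivity) hε]
      exact hN.trans h1
  calc A ^ q.primeFactors.card = ∏ p ∈ q.primeFactors, A := by rw [Finset.prod_const]
    _ ≤ ∏ p ∈ q.primeFactors, (if p < N then A else 1) * (p : ℝ) ^ ε :=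
      Finset.prod_le_prod (fun _ _ => hA0.le) hpt
    _ = A ^ (q.primeFactors.filter (· < N)).card * ((∏ p ∈ q.primeFactors, p : ℕ) : ℝ) ^ ε := by
      rw [Finset.prod_mul_distrib, ← Finset.prod_filter, Finset.prod_const, Nat.cast_prod,
        Real.finsetProd_rpow _ _ fun _ _ => Nat.cast_nonneg _]
    _ ≤ A ^ N * (q : ℝ) ^ ε := by
      gcongr
      · refine (Finset.card_le_card (t := Finset.range N) fun p hp => ?_).trans_eq
          (Finset.card_range N)
        exact Finset.mem_range.mpr (Finset.mem_filter.mp hp).2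
      · exact Nat.le_of_dvd (Nat.pos_of_ne_zero hq) (Nat.prod_primeFactors_dvd q)

end CompositeModulus

section Completion

theorem norm_sum_Ico_pow_le {z : ℂ} (hz : ‖z‖ = 1) (hz1 : z ≠ 1) (a b : ℕ) :
    ‖∑ i ∈ Finset.Ico a b, z ^ i‖ ≤ 2 / ‖z - 1‖ := by
  rcases le_total a b with hab | hab
  · rw [geom_sum_Ico hz1 hab, norm_div]
    gcongr
    refine (norm_sub_le _ _).trans ?_
    rw [norm_pow, norm_pow, hz, one_pow, one_pow]
    norm_num
  · rw [Finset.Ico_eq_empty_of_le hab, Finset.sum_empty, norm_zero]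
    positivity
theorem norm_stdAddChar_natCast_sub_one (q : ℕ) [NeZero q] (k : ℕ) :
    ‖ZMod.stdAddChar (k : ZMod q) - 1‖ = 2 * |Real.sin (Real.pi * k / q)| := by
  have h1 := ZMod.stdAddChar_coe (N := q) k
  rw [Int.cast_natCast] at h1
  have h2 : 2 * Real.pi * Complex.I * ((k : ℤ) : ℂ) / q =
      Complex.I * ((2 * (Real.pi * k / q) : ℝ) : ℂ) := by
    push_cast
    ring
  rw [h1, h2, Complex.norm_exp_I_mul_ofReal_sub_one, mul_div_cancel_left₀ _ two_ne_zero,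
    Real.norm_eq_abs, abs_mul, abs_two]
theorem two_mul_div_le_sin {x y : ℝ} (hx : 0 ≤ x) (hy : 0 < y) (hxy : 2 * x ≤ y) :
    2 * x / y ≤ Real.sin (Real.pi * x / y) := by
  have h1 : Real.pi * x / y ≤ Real.pi / 2 := by
    rw [div_le_div_iff₀ hy two_pos]
    nlinarith [Real.pi_pos]
  refine le_trans (le_of_eq ?_) (Real.mul_le_sin (by positivity) h1)
  field_simp
theorem two_div_norm_stdAddChar_sub_one_le {q : ℕ} [NeZero q] {k : ℕ} (hk : 0 < k) (hkq : k < q) :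
    2 / ‖ZMod.stdAddChar (k : ZMod q) - 1‖ ≤
      (q : ℝ) / 2 * ((k : ℝ)⁻¹ + ((q - k : ℕ) : ℝ)⁻¹) := by
  have hq0 : (0 : ℝ) < q := by exact_mod_cast hk.trans hkq
  have hk0 : (0 : ℝ) < k := by exact_mod_cast hk
  have hkq0 : (0 : ℝ) < q - k := by rw [sub_pos]; exact_mod_cast hkq
  rw [norm_stdAddChar_natCast_sub_one, Nat.cast_sub hkq.le]
  have key : ∀ y : ℝ, 0 < y → 2 * y ≤ q → Real.sin (Real.pi * y / q) = Real.sin (Real.pi * k / q) →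
      2 / (2 * |Real.sin (Real.pi * k / q)|) ≤ (q : ℝ) / 2 * y⁻¹ := by
    intro y hy hyq hs
    have h1 := (two_mul_div_le_sin hy.le hq0 hyq).trans_eq hs
    have h2 : 0 < 2 * y / q := by positivity
    calc 2 / (2 * |Real.sin (Real.pi * k / q)|) ≤ 2 / (2 * (2 * y / q)) := by
          gcongr
          exact h1.trans (le_abs_self _)
      _ = _ := by field_simp
  rcases le_total (2 * (k : ℝ)) q with h | h
  · refine (key k hk0 h rfl).trans ?_
    gcongr
    exact le_add_of_nonneg_right (by positivity)
  · refine (key (q - k) hkq0 (by linarith) ?_).trans ?_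
    · rw [← Real.sin_pi_sub]
      congr 1
      field_simp
      ring
    · gcongr
      exact le_add_of_nonneg_left (by positivity)
theorem sum_norm_sum_Ico_stdAddChar_le (q : ℕ) [NeZero q] (a b : ℕ) (hbq : b ≤ q) :
    ∑ h : ZMod q, ‖∑ x ∈ Finset.Ico a b, ZMod.stdAddChar (h * (x : ZMod q))‖ ≤
      q * (2 + Real.log q) := by
  have hq0 : 0 < q := Nat.pos_of_ne_zero (NeZero.ne q)
  rw [← sum_range_natCast_zmod fun h : ZMod q =>
    ‖∑ x ∈ Finset.Ico a b, ZMod.stdAddChar (h * (x : ZMod q))‖, Finset.range_eq_Ico,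
    Finset.sum_eq_sum_Ico_succ_bot hq0]
  have h0 : ‖∑ x ∈ Finset.Ico a b, ZMod.stdAddChar (((0 : ℕ) : ZMod q) * (x : ZMod q))‖ ≤ q := by
    refine (norm_sum_le _ _).trans ?_
    rw [Finset.sum_congr rfl fun x _ => AddChar.norm_apply _ _, Finset.sum_const, nsmul_eq_mul,
      mul_one, Nat.card_Ico]
    exact_mod_cast (Nat.sub_le b a).trans hbq
  have hterm : ∀ k ∈ Finset.Ico 1 q,
      ‖∑ x ∈ Finset.Ico a b, ZMod.stdAddChar ((k : ZMod q) * (x : ZMod q))‖ ≤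
        (q : ℝ) / 2 * ((k : ℝ)⁻¹ + ((q - k : ℕ) : ℝ)⁻¹) := by
    intro k hk
    rw [Finset.mem_Ico] at hk
    refine le_trans ?_ (two_div_norm_stdAddChar_sub_one_le hk.1 hk.2)
    have h1 : ZMod.stdAddChar (k : ZMod q) ≠ 1 := fun h => by
      rw [← AddChar.map_zero_eq_one (ZMod.stdAddChar (N := q))] at h
      have h2 := ZMod.injective_stdAddChar h
      rw [ZMod.natCast_eq_zero_iff] at h2
      exact absurd (Nat.le_of_dvd hk.1 h2) (not_le.mpr hk.2)
    refine le_trans (le_of_eq ?_) (norm_sum_Ico_pow_le (AddChar.norm_apply _ _) h1 a b)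
    congr 1
    refine Finset.sum_congr rfl fun x _ => ?_
    rw [← AddChar.map_nsmul_eq_pow, nsmul_eq_mul, mul_comm]
  have hharm : ∑ k ∈ Finset.Ico 1 q, (k : ℝ)⁻¹ ≤ 1 + Real.log q := by
    have h1 := harmonic_le_one_add_log q
    rw [harmonic_eq_sum_Icc] at h1
    push_cast at h1
    refine le_trans (Finset.sum_le_sum_of_subset_of_nonneg ?_ fun _ _ _ => by positivity) h1
    exact Finset.Ico_subset_Icc_self
  have hrefl : ∑ k ∈ Finset.Ico 1 q, ((q - k : ℕ) : ℝ)⁻¹ = ∑ k ∈ Finset.Ico 1 q, (k : ℝ)⁻¹ := by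
    refine Finset.sum_nbij' (fun k => q - k) (fun k => q - k) ?_ ?_ ?_ ?_ fun _ _ => rfl <;>
    · intro k hk
      rw [Finset.mem_Ico] at *
      omega
  refine (add_le_add h0 (Finset.sum_le_sum hterm)).trans ?_
  rw [← Finset.mul_sum, Finset.sum_add_distrib, hrefl]
  nlinarith [(Nat.cast_nonneg q : (0 : ℝ) ≤ q)]
theorem exists_filter_range_eq_Ico (q : ℕ) {I : Set ℝ} (hI : I.OrdConnected) :
    ∃ a b : ℕ, b ≤ q ∧ (Finset.range q).filter (fun x : ℕ => (x : ℝ) ∈ I) = Finset.Ico a b := by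
  set A := (Finset.range q).filter (fun x : ℕ => (x : ℝ) ∈ I) with hA
  rcases A.eq_empty_or_nonempty with h | h
  · exact ⟨0, 0, Nat.zero_le q, by rw [h, Finset.Ico_self]⟩
  have hmin := Finset.mem_filter.mp (A.min'_mem h)
  have hmax := Finset.mem_filter.mp (A.max'_mem h)
  refine ⟨A.min' h, A.max' h + 1, Finset.mem_range.mp hmax.1, ?_⟩
  ext x
  rw [Finset.mem_Ico, Nat.lt_succ_iff]
  refine ⟨fun hx => ⟨A.min'_le x hx, A.le_max' x hx⟩, fun hx => Finset.mem_filter.mpr ⟨?_, ?_⟩⟩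
  · exact Finset.mem_range.mpr (hx.2.trans_lt (Finset.mem_range.mp hmax.1))
  · exact hI.out hmin.2 hmax.2 ⟨by exact_mod_cast hx.1, by exact_mod_cast hx.2⟩
theorem kloosterman_eq_sum_units (q : ℕ) [NeZero q] (n : ℤ) (I : Set ℝ) :
    kloosterman q n I = ∑ u : (ZMod q)ˣ, if (((u : ZMod q).val : ℕ) : ℝ) ∈ I then
      ZMod.stdAddChar ((n : ZMod q) * (↑u⁻¹ : ZMod q)) else 0 := by
  rw [kloosterman, ← Finset.sum_filter, ← Finset.sum_filter]
  symm
  refine Finset.sum_bij (fun u _ => (u : ZMod q).val) (fun u hu => ?_)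
    (fun u _ v _ h => Units.ext (ZMod.val_injective q h)) (fun x hx => ?_) (fun u _ => ?_)
  · exact Finset.mem_filter.mpr ⟨Finset.mem_range.mpr (ZMod.val_lt _),
      (Finset.mem_filter.mp hu).2, ZMod.val_coe_unit_coprime u⟩
  · obtain ⟨hxq, hxI, hx⟩ := Finset.mem_filter.mp hx
    have h1 : ((ZMod.unitOfCoprime x hx : (ZMod q)ˣ) : ZMod q).val = x := by
      rw [ZMod.coe_unitOfCoprime, ZMod.val_natCast_of_lt (Finset.mem_range.mp hxq)]
    exact ⟨ZMod.unitOfCoprime x hx, Finset.mem_filter.mpr ⟨Finset.mem_univ _, by rwa [h1]⟩, h1⟩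
  · have h1 : (n : ZMod q) * (↑u⁻¹ : ZMod q) =
        ((n * ((↑u⁻¹ : ZMod q).val : ℤ) : ℤ) : ZMod q) := by
      push_cast
      rw [ZMod.natCast_zmod_val]
    rw [h1, ZMod.stdAddChar_coe, ZMod.natCast_zmod_val, ZMod.inv_coe_unit]
    congr 1
    push_cast
    ring
/-- Completion of an incomplete Kloosterman sum. -/
theorem natCast_mul_kloosterman (q : ℕ) [NeZero q] (n : ℤ) (I : Set ℝ) :
    (q : ℂ) * kloosterman q n I = ∑ h : ZMod q, completeKloosterman q (-h) n *
      ∑ x ∈ (Finset.range q).filter (fun x : ℕ => (x : ℝ) ∈ I),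
        ZMod.stdAddChar (h * (x : ZMod q)) := by
  have horth : ∀ (u : (ZMod q)ˣ) (x : ℕ), x ∈ Finset.range q →
      ∑ h : ZMod q, ZMod.stdAddChar (h * ((x : ZMod q) - (u : ZMod q))) =
        if x = (u : ZMod q).val then (q : ℂ) else 0 := by
    intro u x hx
    rw [AddChar.sum_mulShift _ (ZMod.isPrimitive_stdAddChar q), ZMod.card, Nat.cast_ite,
      Nat.cast_zero]
    refine if_congr (sub_eq_zero.trans ⟨fun h => ?_, fun h => ?_⟩) rfl rfl
    · rw [← h, ZMod.val_natCast_of_lt (Finset.mem_range.mp hx)]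
    · rw [h, ZMod.natCast_zmod_val]
  simp only [completeKloosterman, Finset.sum_mul_sum]
  rw [Finset.sum_comm, kloosterman_eq_sum_units, Finset.mul_sum]
  refine Finset.sum_congr rfl fun u _ => ?_
  rw [Finset.sum_comm]
  have h1 : ∀ x ∈ (Finset.range q).filter (fun x : ℕ => (x : ℝ) ∈ I),
      ∑ h : ZMod q, ZMod.stdAddChar (-h * (u : ZMod q) + (n : ZMod q) * (↑u⁻¹ : ZMod q)) *
        ZMod.stdAddChar (h * (x : ZMod q)) =
      if x = (u : ZMod q).val then
        q * ZMod.stdAddChar ((n : ZMod q) * (↑u⁻¹ : ZMod q)) else 0 := by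
    intro x hx
    rw [← zero_mul (ZMod.stdAddChar ((n : ZMod q) * (↑u⁻¹ : ZMod q))), ← ite_mul,
      ← horth u x (Finset.mem_filter.mp hx).1, Finset.sum_mul]
    refine Finset.sum_congr rfl fun h _ => ?_
    rw [← AddChar.map_add_eq_mul, ← AddChar.map_add_eq_mul]
    congr 1
    ring
  rw [Finset.sum_congr rfl h1, Finset.sum_ite_eq', mul_ite, mul_zero]
  refine if_congr ?_ rfl rfl
  rw [Finset.mem_filter, Finset.mem_range]
  exact ⟨fun h => ⟨ZMod.val_lt _, h⟩, fun h => h.2⟩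
theorem norm_kloosterman_le (q : ℕ) [NeZero q] {I : Set ℝ} (hI : I.OrdConnected) (n : ℤ) :
    ‖kloosterman q n I‖ ≤ 8 ^ q.primeFactors.card * (2 + Real.log q) *
      Real.sqrt (Int.gcd n q) * Real.sqrt q := by
  obtain ⟨a, b, hb, hab⟩ := exists_filter_range_eq_Ico q hI
  have hq0 : (0 : ℝ) < q := by exact_mod_cast Nat.pos_of_ne_zero (NeZero.ne q)
  set B := 8 ^ q.primeFactors.card * Real.sqrt (Int.gcd n q) * Real.sqrt q with hB
  have hB0 : 0 ≤ B := by positivity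
  have hK : ∀ h : ZMod q, ‖completeKloosterman q (-h) n‖ ≤ B := by
    intro h
    obtain ⟨H, hH⟩ := ZMod.intCast_surjective (-h)
    rw [← hH]
    exact norm_completeKloosterman_le_pow_card_primeFactors q H n
  refine le_of_mul_le_mul_left ?_ hq0
  calc (q : ℝ) * ‖kloosterman q n I‖ = ‖(q : ℂ) * kloosterman q n I‖ := by
        rw [norm_mul, Complex.norm_natCast]
    _ ≤ ∑ h : ZMod q, B * ‖∑ x ∈ Finset.Ico a b, ZMod.stdAddChar (h * (x : ZMod q))‖ := by
        rw [natCast_mul_kloosterman, hab]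
        refine (norm_sum_le _ _).trans (Finset.sum_le_sum fun h _ => ?_)
        rw [norm_mul]
        exact mul_le_mul_of_nonneg_right (hK h) (norm_nonneg _)
    _ ≤ B * (q * (2 + Real.log q)) := by
        rw [← Finset.mul_sum]
        exact mul_le_mul_of_nonneg_left (sum_norm_sum_Ico_stdAddChar_le q a b hb) hB0
    _ = _ := by rw [hB]; ring

end Completion

/-- Lemma A2: for every `ε > 0` there is `C_ε` so that for every `q ≥ 2`, every interval
`I ⊆ [0,q)` and every integer `n`, `|S_I(0,n;q)| ≤ C_ε gcd(n,q)^{1/2} q^{1/2+ε}`. -/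
theorem incomplete_kloosterman_bound (ε : ℝ) (hε : 0 < ε) :
    ∃ C : ℝ, ∀ q : ℕ, 2 ≤ q → ∀ I : Set ℝ, I.OrdConnected → I ⊆ Set.Ico 0 (q : ℝ) →
      ∀ n : ℤ,
      ‖kloosterman q n I‖ ≤
        C * Real.sqrt (Int.gcd n (q : ℤ)) * (q : ℝ) ^ ((1 / 2 : ℝ) + ε) := by
  obtain ⟨C, hC0, hC⟩ := exists_pow_card_primeFactors_le 8 (ε / 2) (by norm_num) (by positivity)
  refine ⟨C * (2 + 2 / ε), fun q hq I hI _ n => ?_⟩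
  have : NeZero q := ⟨by omega⟩
  have hq1 : (1 : ℝ) ≤ q := by exact_mod_cast (by omega : 1 ≤ q)
  have hq0 : (0 : ℝ) < q := one_pos.trans_le hq1
  have hlog : 2 + Real.log q ≤ (2 + 2 / ε) * (q : ℝ) ^ (ε / 2) := by
    have h1 := Real.log_le_rpow_div hq0.le (half_pos hε)
    have h2 : (1 : ℝ) ≤ (q : ℝ) ^ (ε / 2) := Real.one_le_rpow hq1 (by positivity)
    rw [div_div_eq_mul_div] at h1
    rw [add_mul, div_mul_eq_mul_div, mul_comm 2 ((q : ℝ) ^ (ε / 2))]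
    linarith
  have hlog0 : 0 ≤ 2 + Real.log q := by linarith [Real.log_nonneg hq1]
  calc ‖kloosterman q n I‖ ≤ 8 ^ q.primeFactors.card * (2 + Real.log q) *
        Real.sqrt (Int.gcd n q) * Real.sqrt q := norm_kloosterman_le q hI n
    _ ≤ (C * (q : ℝ) ^ (ε / 2)) * ((2 + 2 / ε) * (q : ℝ) ^ (ε / 2)) *
        Real.sqrt (Int.gcd n q) * Real.sqrt q := by
      gcongr
      exact hC q (by omega)
    _ = C * (2 + 2 / ε) * Real.sqrt (Int.gcd n q) *
        (Real.sqrt q * ((q : ℝ) ^ (ε / 2) * (q : ℝ) ^ (ε / 2))) := by ring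
    _ = _ := by
      rw [← Real.rpow_add hq0, add_halves, Real.sqrt_eq_rpow q, ← Real.rpow_add hq0]
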